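/- arXiv:2507.06032 — 3 statements merged into one kernel-verified Lean document; each statement's English description precedes it below -/
import Mathlib

section
/- There is a constant C > 0 such that every weighted path augmentation (WPAP) instance admits a deterministic online algorithm ALG satisfying, for every duplicate-free request sequence σ, c(ALG σ) ≤ C · (1 + log(1 + σ.length)) · opt(σ.toFinset), where log is the natural logarithm. -/
open Finset

/-- A weighted path augmentation (WPAP) instance on path edges `Fin n` with links `L`. -/
structure WPAPInstance (n : ℕ) (L : Type) [Fintype L] [DecidableEq L] where
  lo : L → Fin n
  hi : L → Fin n
  lo_le_hi : ∀ ℓ, lo ℓ ≤ hi ℓ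
  cost : L → ℝ
  cost_nonneg : ∀ ℓ, 0 ≤ cost ℓ
  covered : ∀ e : Fin n, ∃ ℓ : L, lo ℓ ≤ e ∧ e ≤ hi ℓ

variable {n : ℕ} {L : Type} [Fintype L] [DecidableEq L]

/-- Cost of a finite set of links. -/
def WPAPInstance.setCost (I : WPAPInstance n L) (T : Finset L) : ℝ :=
  ∑ ℓ ∈ T, I.cost ℓ

/-- `T` covers `A` if every element of `A` lies in the interval of some chosen link. -/
def WPAPInstance.Covers (I : WPAPInstance n L) (T : Finset L) (A : Finset (Fin n)) : Prop :=
  ∀ e ∈ A, ∃ ℓ ∈ T, I.lo ℓ ≤ e ∧ e ≤ I.hi ℓ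

/-- Optimum cost of covering a finite set of elements. -/
noncomputable def WPAPInstance.optCost (I : WPAPInstance n L) (A : Finset (Fin n)) : ℝ :=
  sInf {r : ℝ | ∃ T : Finset L, I.Covers T A ∧ r = I.setCost T}

/-- A deterministic online algorithm: prefix-monotone and always covering. -/
def WPAPInstance.IsOnlineAlg (I : WPAPInstance n L) (ALG : List (Fin n) → Finset L) : Prop :=
  (∀ (σ : List (Fin n)) (x : Fin n), ALG σ ⊆ ALG (σ ++ [x])) ∧
  ∀ σ : List (Fin n), I.Covers (ALG σ) σ.toFinset

/-- The prediction error η(σ) = min(|Xσ|, |Xσ \ X̂| + |X̂ \ Xσ|). -/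
def predErr (Xhat : Finset (Fin n)) (σ : List (Fin n)) : ℕ :=
  min σ.toFinset.card ((σ.toFinset \ Xhat).card + (Xhat \ σ.toFinset).card)


lemma wp_sum_classes (S : Finset ℕ) (j : ℕ → ℤ) (k : ℕ) (Y : ℝ) (hY : 0 ≤ Y) (hk : S.card ≤ k)
    (h1 : ∀ t ∈ S, (2:ℝ) ^ (j t) ≤ Y)
    (h2 : ∀ i : ℤ, ((S.filter (fun t => j t = i)).card : ℝ) * (2:ℝ) ^ i ≤ 4 * Y) :
    ∑ t ∈ S, (2:ℝ) ^ (j t) ≤ Y + 4 * Y * ((Nat.log 2 k : ℝ) + 1) := by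
  classical
  rcases S.eq_empty_or_nonempty with rfl | ⟨t0, ht0⟩
  · simp; positivity
  have hYpos : 0 < Y := lt_of_lt_of_le (by positivity) (h1 t0 ht0)
  have hkpos : 0 < k := lt_of_lt_of_le (Finset.card_pos.mpr ⟨t0, ht0⟩) hk
  set J := Int.log 2 Y with hJ
  set m : ℕ := Nat.log 2 k + 1 with hm
  have hJY : (2:ℝ) ^ J ≤ Y := by
    have := Int.zpow_log_le_self (R := ℝ) (b := 2) (by norm_num) hYpos
    simpa using this
  have hkm : (k:ℝ) ≤ 2 ^ m := by
    exact_mod_cast (Nat.lt_pow_succ_log_self (b := 2) (by norm_num) k).le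
  have hjJ : ∀ t ∈ S, j t ≤ J := by
    intro t ht
    have := h1 t ht
    rw [hJ, ← Int.zpow_le_iff_le_log (by norm_num) hYpos]
    simpa using this
  rw [← Finset.sum_filter_add_sum_filter_not S (fun t => j t ≤ J - m)]
  apply add_le_add
  · have hb : ∀ t ∈ S.filter (fun t => j t ≤ J - m), (2:ℝ) ^ (j t) ≤ Y / k := by
      intro t ht
      have ht2 := (Finset.mem_filter.mp ht).2
      calc (2:ℝ) ^ (j t) ≤ (2:ℝ) ^ (J - m) := zpow_le_zpow_right₀ (by norm_num) ht2
        _ = 2 ^ J / 2 ^ m := by rw [zpow_sub₀ (by norm_num)]; simp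
        _ ≤ Y / k := by
          have : (0:ℝ) < k := by exact_mod_cast hkpos
          gcongr
    calc _ ≤ (S.filter (fun t => j t ≤ J - m)).card • (Y / k) := Finset.sum_le_card_nsmul _ _ _ hb
      _ ≤ k • (Y / k) := by
          apply nsmul_le_nsmul_left (by positivity)
          exact (Finset.card_filter_le _ _).trans hk
      _ = Y := by
          have : (k:ℝ) ≠ 0 := by exact_mod_cast hkpos.ne'
          rw [nsmul_eq_mul]; field_simp
  · have hmaps : ∀ t ∈ S.filter (fun t => ¬ j t ≤ J - m), j t ∈ Finset.Ioc (J - m) J := by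
      intro t ht
      have ht2 := Finset.mem_filter.mp ht
      exact Finset.mem_Ioc.mpr ⟨not_le.mp ht2.2, hjJ t ht2.1⟩
    rw [← Finset.sum_fiberwise_of_maps_to hmaps]
    calc _ ≤ ∑ i ∈ Finset.Ioc (J - m) J, 4 * Y := by
          apply Finset.sum_le_sum
          intro i _
          calc _ = ∑ t ∈ (S.filter (fun t => ¬ j t ≤ J - m)).filter (fun t => j t = i), (2:ℝ)^i := by
                apply Finset.sum_congr rfl
                intro t ht
                rw [(Finset.mem_filter.mp ht).2]
            _ ≤ ((S.filter (fun t => j t = i)).card : ℝ) * (2:ℝ) ^ i := by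
                rw [Finset.sum_const, nsmul_eq_mul]
                gcongr
                exact Finset.filter_subset _ _
            _ ≤ _ := h2 i
      _ = 4 * Y * ((Nat.log 2 k : ℝ) + 1) := by
          rw [Finset.sum_const, nsmul_eq_mul, Int.card_Ioc]
          have : (J - (J - (m:ℤ))).toNat = m := by simp
          rw [this, hm]; push_cast; ring

/-- link `ℓ` covers element `e` -/
def WPAPInstance.Cov (I : WPAPInstance n L) (ℓ : L) (e : Fin n) : Prop :=
  I.lo ℓ ≤ e ∧ e ≤ I.hi ℓ

open Classical in
lemma wp_charge (I : WPAPInstance n L) (N : ℕ) (x : ℕ → Fin n) (d : ℕ → ℝ)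
    (hd : ∀ s, 0 ≤ d s) (S : Finset ℕ) (hS : S ⊆ Finset.range N) (lk : ℕ → L) (A : ℝ) (hA : 0 < A)
    (h0 : ∀ t ∈ S, I.Cov (lk t) (x t))
    (h1 : ∀ t ∈ S, A ≤ ∑ s ∈ Finset.range (t+1), if I.Cov (lk t) (x s) then d s else 0)
    (h2 : ∀ t' ∈ S, ∀ t ∈ S, t' < t → ∀ u ∈ S, I.Cov (lk u) (x t') → I.Cov (lk u) (x t) →
      (∑ s ∈ Finset.range (t'+1), if I.Cov (lk u) (x s) then d s else 0) < A / 2) :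
    (S.card : ℝ) * (A / 2) ≤ 2 * ∑ s ∈ Finset.range N, d s := by
  set F : ℕ → ℕ → Prop := fun t s => s ≤ t ∧ I.Cov (lk t) (x s) ∧
    ∀ t' ∈ S, s ≤ t' → t' < t → ¬ I.Cov (lk t) (x t') with hF
  have h3 : ∀ t' ∈ S, ∀ t ∈ S, t' < t → ¬ I.Cov (lk t') (x t) := by
    intro t' ht' t ht hlt hc
    have a := h2 t' ht' t ht hlt t' ht' (h0 t' ht') hc
    have b := h1 t' ht'
    linarith
  have hfresh : ∀ t ∈ S, A / 2 ≤ ∑ s ∈ Finset.range N, if F t s then d s else 0 := by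
    intro t ht
    have htN : t + 1 ≤ N := Finset.mem_range.mp (hS ht)
    have hmono : (∑ s ∈ Finset.range (t+1), if F t s then d s else 0)
        ≤ ∑ s ∈ Finset.range N, if F t s then d s else 0 := by
      apply Finset.sum_le_sum_of_subset_of_nonneg
      · exact Finset.range_mono htN
      · intro s _ _; split_ifs <;> simp [hd]
    refine le_trans ?_ hmono
    set P := S.filter (fun t' => t' < t ∧ I.Cov (lk t) (x t')) with hP
    rcases P.eq_empty_or_nonempty with hPe | hPne
    · have : (∑ s ∈ Finset.range (t+1), if F t s then d s else 0)
          = ∑ s ∈ Finset.range (t+1), if I.Cov (lk t) (x s) then d s else 0 := by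
        apply Finset.sum_congr rfl
        intro s hs
        have hiff : F t s ↔ I.Cov (lk t) (x s) := by
          constructor
          · exact fun h => h.2.1
          · intro h
            refine ⟨by simpa [Nat.lt_succ_iff] using hs, h, ?_⟩
            intro t' ht' _ hlt hc
            have : t' ∈ P := Finset.mem_filter.mpr ⟨ht', hlt, hc⟩
            rw [hPe] at this
            simp at this
        simp only [hiff]
      rw [this]
      have := h1 t ht
      linarith
    · set q := P.max' hPne
      have hq : q ∈ P := P.max'_mem hPne
      obtain ⟨hqS, hqt, hqc⟩ := Finset.mem_filter.mp hq
      have hold := h2 q hqS t ht hqt t ht hqc (h0 t ht)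
      have htot := h1 t ht
      have hsplit : (∑ s ∈ Finset.range (t+1), if I.Cov (lk t) (x s) then d s else 0)
          ≤ (∑ s ∈ Finset.range (q+1), if I.Cov (lk t) (x s) then d s else 0)
            + ∑ s ∈ Finset.range (t+1), if F t s then d s else 0 := by
        have hsub : (∑ s ∈ Finset.range (q+1), if I.Cov (lk t) (x s) then d s else 0)
          = ∑ s ∈ Finset.range (t+1), if s < q+1 then (if I.Cov (lk t) (x s) then d s else 0) else 0 := by
          rw [← Finset.sum_filter (fun s => s < q + 1)]
          apply Finset.sum_congr _ (fun _ _ => rfl)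
          ext s; simp only [Finset.mem_range, Finset.mem_filter]; omega
        rw [hsub, ← Finset.sum_add_distrib]
        apply Finset.sum_le_sum
        intro s hs
        have hdn := hd s
        by_cases hsq : s < q + 1
        · simp only [hsq, if_true]
          have : (0:ℝ) ≤ if F t s then d s else 0 := by split_ifs <;> simp [hdn]
          linarith
        · simp only [hsq, if_false, zero_add]
          by_cases hc : I.Cov (lk t) (x s)
          · have : F t s := by
              refine ⟨by simpa [Nat.lt_succ_iff] using hs, hc, ?_⟩
              intro t' ht' hst hlt hc'
              have h5 : t' ≤ q := P.le_max' t' (Finset.mem_filter.mpr ⟨ht', hlt, hc'⟩)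
              omega
            simp [this, hc]
          · simp only [hc, if_false]; split_ifs <;> simp [hdn]
      linarith
  have hcount : ∀ s, ((S.filter (fun t => F t s)).card : ℝ) ≤ 2 := by
    intro s
    have hle : (S.filter (fun t => F t s ∧ x t ≤ x s)).card ≤ 1 := by
      rw [Finset.card_le_one]
      have key : ∀ a ∈ S.filter (fun t => F t s ∧ x t ≤ x s), ∀ b ∈ S.filter (fun t => F t s ∧ x t ≤ x s), ¬ a < b := by
        intro a ha b hb hab
        obtain ⟨haS, ⟨hsa, hac, haF⟩, hax⟩ := Finset.mem_filter.mp ha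
        obtain ⟨hbS, ⟨hsb, hbc, hbF⟩, hbx⟩ := Finset.mem_filter.mp hb
        have hn := h3 a haS b hbS hab
        have ha0 := h0 a haS
        have hb0 := h0 b hbS
        have hlt : x b < x a := by
          by_contra hcon
          push Not at hcon
          exact hn ⟨ha0.1.trans hcon, hbx.trans hac.2⟩
        exact hbF a haS hsa hab ⟨hb0.1.trans hlt.le, hax.trans hbc.2⟩
      intro a ha b hb
      have := key a ha b hb
      have := key b hb a ha
      omega
    have hge : (S.filter (fun t => F t s ∧ x s ≤ x t)).card ≤ 1 := by
      rw [Finset.card_le_one]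
      have key : ∀ a ∈ S.filter (fun t => F t s ∧ x s ≤ x t), ∀ b ∈ S.filter (fun t => F t s ∧ x s ≤ x t), ¬ a < b := by
        intro a ha b hb hab
        obtain ⟨haS, ⟨hsa, hac, haF⟩, hax⟩ := Finset.mem_filter.mp ha
        obtain ⟨hbS, ⟨hsb, hbc, hbF⟩, hbx⟩ := Finset.mem_filter.mp hb
        have hn := h3 a haS b hbS hab
        have ha0 := h0 a haS
        have hb0 := h0 b hbS
        have hlt : x a < x b := by
          by_contra hcon
          push Not at hcon
          exact hn ⟨hac.1.trans hbx, hcon.trans ha0.2⟩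
        exact hbF a haS hsa hab ⟨hbc.1.trans hax, hlt.le.trans hb0.2⟩
      intro a ha b hb
      have := key a ha b hb
      have := key b hb a ha
      omega
    have hsub : S.filter (fun t => F t s) ⊆ S.filter (fun t => F t s ∧ x t ≤ x s) ∪ S.filter (fun t => F t s ∧ x s ≤ x t) := by
      intro t ht
      obtain ⟨a, b⟩ := Finset.mem_filter.mp ht
      rcases le_total (x t) (x s) with h | h
      · exact Finset.mem_union_left _ (Finset.mem_filter.mpr ⟨a, b, h⟩)
      · exact Finset.mem_union_right _ (Finset.mem_filter.mpr ⟨a, b, h⟩)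
    have := (Finset.card_le_card hsub).trans (Finset.card_union_le _ _)
    have : (S.filter (fun t => F t s)).card ≤ 2 := by omega
    exact_mod_cast this
  calc (S.card : ℝ) * (A / 2) = ∑ t ∈ S, A / 2 := by rw [Finset.sum_const, nsmul_eq_mul]
    _ ≤ ∑ t ∈ S, ∑ s ∈ Finset.range N, if F t s then d s else 0 := Finset.sum_le_sum hfresh
    _ = ∑ s ∈ Finset.range N, ∑ t ∈ S, if F t s then d s else 0 := Finset.sum_comm
    _ ≤ ∑ s ∈ Finset.range N, 2 * d s := by
        apply Finset.sum_le_sum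
        intro s _
        rw [← Finset.sum_filter, Finset.sum_const, nsmul_eq_mul]
        exact mul_le_mul_of_nonneg_right (hcount s) (hd s)
    _ = _ := by rw [Finset.mul_sum]

/-- valid states -/
def WPAPInstance.Good (I : WPAPInstance n L) (p : (L → ℝ) × Finset L) : Prop :=
  (∀ ℓ, p.1 ℓ ≤ I.cost ℓ) ∧ ∀ ℓ, I.cost ℓ = 0 → ℓ ∈ p.2

open Classical in
lemma wp_step (I : WPAPInstance n L) (p : {p : (L → ℝ) × Finset L // I.Good p}) (x : Fin n) :
    ∃ (q : {p : (L → ℝ) × Finset L // I.Good p}) (d : ℝ) (tr : Bool) (l0 : L), 0 ≤ d ∧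
      p.1.2 ⊆ q.1.2 ∧ (∃ ℓ ∈ q.1.2, I.Cov ℓ x) ∧
      (∀ ℓ, q.1.1 ℓ = p.1.1 ℓ + if I.Cov ℓ x then d else 0) ∧
      (tr = false → q.1.2 = p.1.2) ∧
      (tr = true → (∀ ℓ ∈ p.1.2, ¬ I.Cov ℓ x) ∧ I.Cov l0 x ∧ 0 < I.cost l0 ∧
        q.1.1 l0 = I.cost l0 ∧
        I.setCost q.1.2 ≤ I.setCost p.1.2 + 4 * (2:ℝ) ^ (Int.log 2 (I.cost l0)) ∧
        ∀ ℓ, I.Cov ℓ x → Int.log 2 (I.cost ℓ) = Int.log 2 (I.cost l0) → 0 < I.cost ℓ →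
          (2:ℝ) ^ (Int.log 2 (I.cost l0)) / 2 ≤ q.1.1 ℓ →
          ∀ e, I.Cov ℓ e → ∃ m ∈ q.1.2, I.Cov m e) := by
  obtain ⟨⟨W, T⟩, hW, hT⟩ := p
  simp only at hW hT
  by_cases hx : ∃ ℓ ∈ T, I.Cov ℓ x
  · obtain ⟨l, _, _⟩ := id hx
    refine ⟨⟨(W, T), hW, hT⟩, 0, false, l, le_rfl, Finset.Subset.refl _, hx, ?_, ?_, ?_⟩ <;> simp
  push Not at hx
  set U : Finset L := Finset.univ.filter (fun ℓ => I.Cov ℓ x) with hU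
  have hUne : U.Nonempty := by
    obtain ⟨l, hl⟩ := I.covered x
    exact ⟨l, Finset.mem_filter.mpr ⟨Finset.mem_univ _, hl⟩⟩
  obtain ⟨l0, hl0U, hl0⟩ := U.exists_min_image (fun ℓ => I.cost ℓ - W ℓ) hUne
  have hl0c : I.Cov l0 x := (Finset.mem_filter.mp hl0U).2
  have hpos : ∀ ℓ, I.Cov ℓ x → 0 < I.cost ℓ := by
    intro ℓ hc
    rcases (I.cost_nonneg ℓ).lt_or_eq with h | h
    · exact h
    · exact absurd hc (hx ℓ (hT ℓ h.symm))
  set d := I.cost l0 - W l0 with hdd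
  have hd : 0 ≤ d := sub_nonneg.mpr (hW l0)
  set W' : L → ℝ := fun ℓ => W ℓ + if I.Cov ℓ x then d else 0 with hW'
  have hW'le : ∀ ℓ, W' ℓ ≤ I.cost ℓ := by
    intro ℓ
    by_cases hc : I.Cov ℓ x
    · have := hl0 ℓ (by simp [hU, hc])
      simp only [hW', hc, if_true]; linarith
    · simp only [hW', hc, if_false, add_zero]; exact hW ℓ
  have hW'l0 : W' l0 = I.cost l0 := by simp [hW', hl0c, hdd]
  set j := Int.log 2 (I.cost l0) with hj
  have hlow : (2:ℝ) ^ j ≤ I.cost l0 := by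
    simpa using Int.zpow_log_le_self (R := ℝ) (b := 2) (by norm_num) (hpos l0 hl0c)
  set V : Finset L := U.filter (fun ℓ => Int.log 2 (I.cost ℓ) = j ∧ (2:ℝ)^j / 2 ≤ W' ℓ) with hV
  have hVne : V.Nonempty := by
    refine ⟨l0, Finset.mem_filter.mpr ⟨hl0U, rfl, ?_⟩⟩
    rw [hW'l0]
    have : (0:ℝ) < 2 ^ j := by positivity
    linarith
  obtain ⟨a, haV, ha⟩ := V.exists_min_image I.lo hVne
  obtain ⟨b, hbV, hb⟩ := V.exists_max_image I.hi hVne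
  have hVcov : ∀ ℓ ∈ V, I.Cov ℓ x := fun ℓ h => (Finset.mem_filter.mp (Finset.mem_filter.mp h).1).2
  have hVcost : ∀ ℓ ∈ V, I.cost ℓ ≤ 2 * (2:ℝ)^j := by
    intro ℓ h
    have h1 := (Finset.mem_filter.mp h).2.1
    have := Int.lt_zpow_succ_log_self (R := ℝ) (b := 2) (by norm_num) (I.cost ℓ)
    rw [h1, zpow_add_one₀ (by norm_num)] at this
    push_cast at this
    linarith
  refine ⟨⟨(W', T ∪ {a, b}), hW'le, fun ℓ h => Finset.mem_union_left _ (hT ℓ h)⟩, d, true, l0, hd,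
    Finset.subset_union_left, ⟨a, by simp, hVcov a haV⟩, fun ℓ => rfl, by simp, fun _ => ?_⟩
  refine ⟨hx, hl0c, hpos l0 hl0c, hW'l0, ?_, ?_⟩
  · have e1 : I.setCost (T ∪ {a, b}) ≤ I.setCost T + I.setCost {a, b} := by
      unfold WPAPInstance.setCost
      rw [← Finset.sum_union_inter]
      have : 0 ≤ ∑ ℓ ∈ T ∩ {a, b}, I.cost ℓ := Finset.sum_nonneg (fun ℓ _ => I.cost_nonneg ℓ)
      linarith
    have e2 : I.setCost {a, b} ≤ I.cost a + I.cost b := by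
      unfold WPAPInstance.setCost
      by_cases hab : a = b
      · subst hab; simp [I.cost_nonneg]
      · rw [Finset.sum_pair hab]
    have := hVcost a haV
    have := hVcost b hbV
    simp only
    linarith
  · intro ℓ hc hlog _ hm e he
    have hlV : ℓ ∈ V := Finset.mem_filter.mpr ⟨by simp [hU, hc], hlog, hm⟩
    rcases le_total e x with h | h
    · exact ⟨a, by simp, (ha ℓ hlV).trans he.1, h.trans (hVcov a haV).2⟩
    · exact ⟨b, by simp, (hVcov b hbV).1.trans h, he.2.trans (hb ℓ hlV)⟩

open Classical in
lemma wp_dual (I : WPAPInstance n L) (N : ℕ) (x : ℕ → Fin n) (d : ℕ → ℝ) (hd : ∀ s, 0 ≤ d s)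
    (hf : ∀ ℓ, (∑ s ∈ Finset.range N, if I.Cov ℓ (x s) then d s else 0) ≤ I.cost ℓ)
    (A : Finset (Fin n)) (hA : ∀ s < N, x s ∈ A) :
    ∑ s ∈ Finset.range N, d s ≤ I.optCost A := by
  apply le_csInf
  · exact ⟨_, Finset.univ, fun e _ => by obtain ⟨l, hl⟩ := I.covered e; exact ⟨l, by simp, hl⟩, rfl⟩
  · rintro r ⟨T, hT, rfl⟩
    calc ∑ s ∈ Finset.range N, d s
        ≤ ∑ s ∈ Finset.range N, ∑ ℓ ∈ T, if I.Cov ℓ (x s) then d s else 0 := by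
          apply Finset.sum_le_sum
          intro s hs
          obtain ⟨l, hlT, hl⟩ := hT (x s) (hA s (Finset.mem_range.mp hs))
          have hl' : I.Cov l (x s) := hl
          calc d s = if I.Cov l (x s) then d s else 0 := by simp [hl']
            _ ≤ _ := Finset.single_le_sum (f := fun ℓ => if I.Cov ℓ (x s) then d s else 0)
                (fun ℓ _ => by split_ifs <;> simp [hd]) hlT
      _ = ∑ ℓ ∈ T, ∑ s ∈ Finset.range N, if I.Cov ℓ (x s) then d s else 0 := Finset.sum_comm
      _ ≤ ∑ ℓ ∈ T, I.cost ℓ := Finset.sum_le_sum (fun ℓ _ => hf ℓ)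

open Classical in
lemma wp_main (I : WPAPInstance n L) :
    ∃ ALG : List (Fin n) → Finset L, I.IsOnlineAlg ALG ∧
      ∀ σ : List (Fin n), I.setCost (ALG σ) ≤
        4 * (1 + 4 * ((Nat.log 2 σ.length : ℝ) + 1)) * I.optCost σ.toFinset := by
  choose nxt df tr lk hd hsub hcov hW hfalse htrue using wp_step I
  let init : {p : (L → ℝ) × Finset L // I.Good p} :=
    ⟨(fun _ => 0, Finset.univ.filter (fun ℓ => I.cost ℓ = 0)), fun ℓ => I.cost_nonneg ℓ,
      fun ℓ h => by simp [h]⟩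
  refine ⟨fun σ => (σ.foldl nxt init).1.2, ⟨?_, ?_⟩, ?_⟩
  · intro σ x
    simp only [List.foldl_append, List.foldl_cons, List.foldl_nil]
    exact hsub _ _
  · intro σ
    induction σ using List.reverseRecOn with
    | nil => intro e he; simp at he
    | append_singleton σ x ih =>
      intro e he
      simp only [List.foldl_append, List.foldl_cons, List.foldl_nil]
      simp only [List.toFinset_append, Finset.mem_union, List.mem_toFinset, List.mem_singleton] at he
      rcases he with he | rfl
      · obtain ⟨l, hl, h⟩ := ih e (by simpa using he)
        exact ⟨l, hsub _ _ hl, h⟩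
      · exact hcov _ _
  · intro σ
    have hopt0 : 0 ≤ I.optCost σ.toFinset := by
      apply Real.sInf_nonneg
      rintro r ⟨T, _, rfl⟩
      exact Finset.sum_nonneg (fun ℓ _ => I.cost_nonneg ℓ)
    have hinit : I.setCost init.1.2 = 0 := by
      unfold WPAPInstance.setCost
      apply Finset.sum_eq_zero
      intro ℓ hℓ
      exact (Finset.mem_filter.mp hℓ).2
    rcases σ.eq_nil_or_concat with rfl | ⟨σ', y, hσ'⟩
    · simp only [List.foldl_nil]
      rw [hinit]
      positivity
    set x : ℕ → Fin n := fun t => σ.getD t y with hx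
    set st : ℕ → {p : (L → ℝ) × Finset L // I.Good p} := fun t => (σ.take t).foldl nxt init with hst
    set N := σ.length with hN
    have hst0 : st 0 = init := by simp [hst]
    have hsts : ∀ t < N, st (t+1) = nxt (st t) (x t) := by
      intro t ht
      simp only [hst, hx]
      rw [List.take_add_one, List.foldl_append, List.getElem?_eq_getElem ht]
      simp [List.getD_eq_getElem?_getD, List.getElem?_eq_getElem ht]
    have hstN : st N = σ.foldl nxt init := by simp [hst, hN]
    set d : ℕ → ℝ := fun t => df (st t) (x t) with hdd
    have hd0 : ∀ t, 0 ≤ d t := fun t => hd _ _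
    have hWs : ∀ t ≤ N, ∀ ℓ, (st t).1.1 ℓ = ∑ s ∈ Finset.range t, if I.Cov ℓ (x s) then d s else 0 := by
      intro t
      induction t with
      | zero => intro _ ℓ; rw [hst0]; simp [init]
      | succ t ih =>
        intro ht ℓ
        rw [Finset.sum_range_succ, ← ih (by omega) ℓ, hsts t (by omega), hW]
    have hmono : ∀ t' t, t' ≤ t → t ≤ N → (st t').1.2 ⊆ (st t).1.2 := by
      intro t' t h
      induction t, h using Nat.le_induction with
      | base => intro _; exact Finset.Subset.refl _
      | succ t h ih =>
        intro ht
        rw [hsts t (by omega)]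
        exact (ih (by omega)).trans (hsub _ _)
    set l : ℕ → L := fun t => lk (st t) (x t) with hl
    set j : ℕ → ℤ := fun t => Int.log 2 (I.cost (l t)) with hj
    set S : Finset ℕ := (Finset.range N).filter (fun t => tr (st t) (x t) = true) with hS
    set Y := ∑ s ∈ Finset.range N, d s with hY
    have hY0 : 0 ≤ Y := Finset.sum_nonneg (fun s _ => hd0 s)
    have hcost : ∀ t ≤ N, I.setCost (st t).1.2 ≤
        4 * ∑ s ∈ S.filter (fun s => s < t), (2:ℝ) ^ (j s) := by
      intro t
      induction t with
      | zero => intro _; rw [hst0, hinit]; simp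
      | succ t ih =>
        intro ht
        have ih' := ih (by omega)
        rw [hsts t (by omega)]
        by_cases htr : tr (st t) (x t) = true
        · have h1 := (htrue _ _ htr).2.2.2.2.1
          have : S.filter (fun s => s < t + 1) = insert t (S.filter (fun s => s < t)) := by
            ext s
            simp only [Finset.mem_filter, Finset.mem_insert]
            constructor
            · rintro ⟨a, b⟩
              rcases Nat.lt_succ_iff_lt_or_eq.mp b with h | h
              · exact Or.inr ⟨a, h⟩
              · exact Or.inl h
            · rintro (rfl | ⟨a, b⟩)
              · exact ⟨Finset.mem_filter.mpr ⟨Finset.mem_range.mpr (by omega), htr⟩, by omega⟩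
              · exact ⟨a, by omega⟩
          rw [this, Finset.sum_insert (by simp)]
          have : (2:ℝ) ^ (j t) = (2:ℝ) ^ (Int.log 2 (I.cost (lk (st t) (x t)))) := rfl
          rw [this]
          linarith
        · rw [hfalse _ _ (by simpa using htr)]
          refine ih'.trans ?_
          apply mul_le_mul_of_nonneg_left _ (by norm_num)
          apply Finset.sum_le_sum_of_subset_of_nonneg
          · intro s hs
            simp only [Finset.mem_filter] at hs ⊢
            exact ⟨hs.1, by omega⟩
          · intros; positivity
    have hSN : ∀ t ∈ S, t < N := fun t ht => Finset.mem_range.mp (Finset.mem_filter.mp ht).1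
    have hStr : ∀ t ∈ S, tr (st t) (x t) = true := fun t ht => (Finset.mem_filter.mp ht).2
    have hpow : ∀ t ∈ S, (2:ℝ) ^ (j t) ≤
        ∑ s ∈ Finset.range (t+1), if I.Cov (l t) (x s) then d s else 0 := by
      intro t ht
      obtain ⟨_, _, hp, he, _⟩ := htrue _ _ (hStr t ht)
      rw [← hWs (t+1) (hSN t ht), hsts t (hSN t ht)]
      rw [show nxt (st t) (x t) = nxt (st t) (x t) from rfl, he]
      simpa using Int.zpow_log_le_self (R := ℝ) (b := 2) (by norm_num) hp
    have hcls : ∑ t ∈ S, (2:ℝ) ^ (j t) ≤ Y + 4 * Y * ((Nat.log 2 N : ℝ) + 1) := by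
      apply wp_sum_classes S j N Y hY0
      · exact (Finset.card_filter_le _ _).trans (by simp)
      · intro t ht
        refine (hpow t ht).trans ?_
        calc _ ≤ ∑ s ∈ Finset.range (t+1), d s := by
              apply Finset.sum_le_sum; intro s _; split_ifs <;> simp [hd0]
          _ ≤ Y := by
              apply Finset.sum_le_sum_of_subset_of_nonneg
              · exact Finset.range_mono (hSN t ht)
              · intros; exact hd0 _
      · intro i
        have hmem : ∀ t ∈ S.filter (fun t => j t = i), t ∈ S ∧ j t = i := fun t ht => Finset.mem_filter.mp ht
        have := wp_charge I N x d hd0 (S.filter (fun t => j t = i))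
          ((Finset.filter_subset _ _).trans (Finset.filter_subset _ _)) l ((2:ℝ)^i) (by positivity)
          (fun t ht => (htrue _ _ (hStr t (hmem t ht).1)).2.1)
          (fun t ht => by
            have := hpow t (hmem t ht).1
            rwa [(hmem t ht).2] at this)
          (by
            intro t' ht' t ht hlt u hu hc' hc
            by_contra hcon
            push Not at hcon
            obtain ⟨ht'S, ht'i⟩ := hmem t' ht'
            obtain ⟨htS, hti⟩ := hmem t ht
            obtain ⟨huS, hui⟩ := hmem u hu
            have hbig := (htrue _ _ (hStr t' ht'S)).2.2.2.2.2 (l u) hc' (hui.trans ht'i.symm)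
              (htrue _ _ (hStr u huS)).2.2.1 (by
                rw [← hsts t' (hSN t' ht'S), hWs (t'+1) (hSN t' ht'S)]
                have : Int.log 2 (I.cost (lk (st t') (x t'))) = i := ht'i
                rw [this]
                exact hcon) (x t) hc
            obtain ⟨m, hm, hmc⟩ := hbig
            rw [← hsts t' (hSN t' ht'S)] at hm
            exact (htrue _ _ (hStr t htS)).1 m (hmono (t'+1) t hlt (hSN t htS).le hm) hmc)
        linarith
    have hdual : Y ≤ I.optCost σ.toFinset := by
      apply wp_dual I N x d hd0
      · intro ℓ
        rw [← hWs N le_rfl ℓ]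
        exact (st N).2.1 ℓ
      · intro s hs
        simp only [hx]
        rw [List.getD_eq_getElem _ _ hs]
        simp
    have hfin := hcost N le_rfl
    have hSf : S.filter (fun s => s < N) = S := Finset.filter_true_of_mem hSN
    rw [hSf, hstN] at hfin
    calc _ ≤ _ := hfin
      _ ≤ 4 * (Y + 4 * Y * ((Nat.log 2 N : ℝ) + 1)) := by linarith
      _ = 4 * (1 + 4 * ((Nat.log 2 N : ℝ) + 1)) * Y := by ring
      _ ≤ _ := by gcongr

theorem stmt8 :
    ∃ C : ℝ, 0 < C ∧
      ∀ (n : ℕ) (L : Type) [Fintype L] [DecidableEq L], 1 ≤ n →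
        ∀ I : WPAPInstance n L,
          ∃ ALG : List (Fin n) → Finset L, I.IsOnlineAlg ALG ∧
            ∀ σ : List (Fin n), σ.Nodup →
              I.setCost (ALG σ) ≤
                C * (1 + Real.log (1 + (σ.length : ℝ))) * I.optCost σ.toFinset := by
  refine ⟨40, by norm_num, ?_⟩
  intro n L _ _ _ I
  obtain ⟨ALG, h1, h2⟩ := wp_main I
  refine ⟨ALG, h1, fun σ _ => (h2 σ).trans ?_⟩
  have hopt0 : 0 ≤ I.optCost σ.toFinset := by
    apply Real.sInf_nonneg
    rintro r ⟨T, _, rfl⟩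
    exact Finset.sum_nonneg (fun ℓ _ => I.cost_nonneg ℓ)
  apply mul_le_mul_of_nonneg_right _ hopt0
  have hlog : (Nat.log 2 σ.length : ℝ) * Real.log 2 ≤ Real.log (1 + (σ.length : ℝ)) := by
    rw [← Real.log_pow]
    apply Real.log_le_log (by positivity)
    rcases Nat.eq_zero_or_pos σ.length with h | h
    · simp [h]
    · have := Nat.pow_log_le_self 2 h.ne'
      have h3 : ((2 ^ Nat.log 2 σ.length : ℕ) : ℝ) ≤ σ.length := by exact_mod_cast this
      push_cast at h3
      linarith
  have h2 : (0.69:ℝ) < Real.log 2 := by have := Real.log_two_gt_d9; linarith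
  have h0 : (0:ℝ) ≤ (Nat.log 2 σ.length : ℝ) := by positivity
  nlinarith
end

section
/- There is a constant C > 0 such that every weighted path augmentation (WPAP) instance admits a randomized online algorithm μ (a PMF on maps List (Fin n) → Finset L whose support consists of deterministic online algorithms) satisfying, for every duplicate-free request sequence σ, E_{A∼μ}[c(A σ)] ≤ C · (1 + log(1 + log(1 + σ.length))) · opt(σ.toFinset), where log is the natural logarithm. -/
open Finset

variable {n : ℕ} {L : Type} [Fintype L] [DecidableEq L]

namespace WP

open Classical in
/-- greedy grouping of naturals -/
noncomputable def greedy (P : ℕ → ℕ → Prop) : ℕ → ℕ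
  | 0 => 0
  | x + 1 => if P (greedy P x) (x + 1) then greedy P x else x + 1

lemma greedy_le (P : ℕ → ℕ → Prop) (x : ℕ) : greedy P x ≤ x := by
  induction x with
  | zero => simp [greedy]
  | succ x ih => simp only [greedy]; split_ifs <;> omega

lemma greedy_mono (P : ℕ → ℕ → Prop) : Monotone (greedy P) := by
  apply monotone_nat_of_le_succ
  intro x
  have := greedy_le P x
  simp only [greedy]; split_ifs <;> omega

lemma greedy_cov (P : ℕ → ℕ → Prop) (x : ℕ) : P (greedy P x) x ∨ greedy P x = x := by
  cases x with
  | zero => right; simp [greedy]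
  | succ x => simp only [greedy]; split_ifs with h
              · left; exact h
              · right; rfl

lemma greedy_two (P : ℕ → ℕ → Prop)
    (hP : ∀ a b a' b', P a b → a ≤ a' → b' ≤ b → P a' b') (a b x : ℕ) (h : P a b)
    (hax : a ≤ x) (hxb : x ≤ b) : greedy P x = greedy P a ∨ greedy P x = greedy P b := by
  have h1 : ∀ x, a ≤ x → greedy P x = greedy P a ∨ a < greedy P x := by
    intro x hx
    induction x, hx using Nat.le_induction with
    | base => left; rfl
    | succ x hx ih =>
      simp only [greedy]; split_ifs
      · exact ih
      · right; omega
  have h2 : a ≤ greedy P x → ∀ z, x ≤ z → z ≤ b → greedy P z = greedy P x := by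
    intro hag z hz
    induction z, hz using Nat.le_induction with
    | base => intro _; rfl
    | succ z hz ih =>
      intro hzb
      have := ih (by omega)
      simp only [greedy]
      rw [this, if_pos]
      exact hP _ _ _ _ h hag hzb
  rcases h1 x hax with h3 | h3
  · left; exact h3
  · right; exact (h2 h3.le b hxb le_rfl).symm

/-- the interval `[a,b]` can be covered at cost at most `c` -/
def CovI (I : WPAPInstance n L) (c : ℝ) (a b : ℕ) : Prop :=
  ∃ T : Finset L, (∀ e : Fin n, a ≤ e.val → e.val ≤ b → ∃ ℓ ∈ T, I.lo ℓ ≤ e ∧ e ≤ I.hi ℓ) ∧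
    I.setCost T ≤ c

lemma setCost_union_le (I : WPAPInstance n L) (S T : Finset L) :
    I.setCost (S ∪ T) ≤ I.setCost S + I.setCost T := by
  unfold WPAPInstance.setCost
  rw [← Finset.sum_union_inter]
  have : 0 ≤ ∑ ℓ ∈ S ∩ T, I.cost ℓ := Finset.sum_nonneg fun _ _ => I.cost_nonneg _
  linarith

lemma CovI.mono {I : WPAPInstance n L} {c c' : ℝ} {a b a' b' : ℕ} (h : CovI I c a b)
    (hc : c ≤ c') (ha : a ≤ a') (hb : b' ≤ b) : CovI I c' a' b' := by
  obtain ⟨T, h1, h2⟩ := h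
  exact ⟨T, fun e h3 h4 => h1 e (by omega) (by omega), by linarith⟩

lemma CovI.union {I : WPAPInstance n L} {c c' : ℝ} {a b m : ℕ} (h : CovI I c a m)
    (h' : CovI I c' m b) : CovI I (c + c') a b := by
  obtain ⟨T, h1, h2⟩ := h
  obtain ⟨T', h1', h2'⟩ := h'
  refine ⟨T ∪ T', fun e h3 h4 => ?_, by linarith [setCost_union_le I T T']⟩
  rcases le_total e.val m with h | h
  · obtain ⟨ℓ, h5, h6⟩ := h1 e h3 h
    exact ⟨ℓ, Finset.mem_union_left _ h5, h6⟩
  · obtain ⟨ℓ, h5, h6⟩ := h1' e h h4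
    exact ⟨ℓ, Finset.mem_union_right _ h5, h6⟩

noncomputable def seg (I : WPAPInstance n L) (c0 : ℝ) : ℕ → ℕ → ℕ
  | 0 => fun x => x
  | i + 1 => fun x => greedy (CovI I (2 * (c0 * 4 ^ i))) (seg I c0 i x)

lemma seg_le (I : WPAPInstance n L) (c0 : ℝ) (i x : ℕ) : seg I c0 i x ≤ x := by
  induction i with
  | zero => simp [seg]
  | succ i ih => exact (greedy_le _ _).trans ih

lemma seg_mono (I : WPAPInstance n L) (c0 : ℝ) (i : ℕ) : Monotone (seg I c0 i) := by
  induction i with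
  | zero => exact fun a b h => h
  | succ i ih => exact (greedy_mono _).comp ih

lemma seg_cov (I : WPAPInstance n L) (c0 : ℝ) (h0 : 0 < c0) (i x : ℕ) :
    CovI I (3 * (c0 * 4 ^ i) / 4) (seg I c0 i x) x ∨ seg I c0 i x = x := by
  induction i with
  | zero => right; rfl
  | succ i ih =>
    have hp : 0 < c0 * 4 ^ i := by positivity
    have e1 : 3 * (c0 * 4 ^ (i + 1)) / 4 = 3 * (c0 * 4 ^ i) := by ring
    rw [e1]
    have h := greedy_cov (CovI I (2 * (c0 * 4 ^ i))) (seg I c0 i x)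
    change CovI I _ (greedy _ _) _ ∨ greedy _ _ = x
    rcases h with h | h <;> rcases ih with ih | ih
    · left; exact (h.union ih).mono (by linarith) le_rfl le_rfl
    · left; rw [ih] at h ⊢; exact h.mono (by linarith) le_rfl le_rfl
    · left; rw [h]; exact ih.mono (by linarith) le_rfl le_rfl
    · right; rw [h, ih]

lemma seg_two (I : WPAPInstance n L) (c0 : ℝ) (h0 : 0 < c0) (i : ℕ) (ℓ : L)
    (hℓ : I.cost ℓ ≤ c0 * 4 ^ i) : ∃ s1 s2, ∀ e : Fin n, I.lo ℓ ≤ e → e ≤ I.hi ℓ →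
      seg I c0 (i + 1) e = s1 ∨ seg I c0 (i + 1) e = s2 := by
  have hp : 0 < c0 * 4 ^ i := by positivity
  have hl : CovI I (c0 * 4 ^ i) (I.lo ℓ) (I.hi ℓ) :=
    ⟨{ℓ}, fun e h1 h2 => ⟨ℓ, by simp, h1, h2⟩, by simpa [WPAPInstance.setCost] using hℓ⟩
  have hc : CovI I (2 * (c0 * 4 ^ i)) (seg I c0 i (I.lo ℓ)) (I.hi ℓ) := by
    rcases seg_cov I c0 h0 i (I.lo ℓ) with h | h
    · exact (h.union hl).mono (by linarith) le_rfl le_rfl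
    · rw [h]; exact hl.mono (by linarith) le_rfl le_rfl
  refine ⟨_, _, fun e h1 h2 => greedy_two (CovI I (2 * (c0 * 4 ^ i))) ?_ _ _ (seg I c0 i e) hc
    (seg_mono I c0 i h1) ((seg_le _ _ _ _).trans h2)⟩
  intro a b a' b' h ha hb
  exact h.mono le_rfl ha hb

/-- data of the laminar reduction -/
structure Lam (I : WPAPInstance n L) where
  c0 : ℝ
  c0_pos : 0 < c0
  sg : ℕ → Fin n → ℕ
  lev : Fin n → ℕ
  T : ℕ → ℕ → Finset L
  sg_lt : ∀ i e, sg i e < n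
  lam : ∀ i e e', sg i e = sg i e' → sg (i + 1) e = sg (i + 1) e'
  T_cost : ∀ i s, I.setCost (T i s) ≤ 3 * (c0 * 4 ^ i)
  T_cov : ∀ i e, lev e ≤ i → ∃ ℓ ∈ T i (sg i e), I.lo ℓ ≤ e ∧ e ≤ I.hi ℓ
  link : ∀ ℓ, 0 < I.cost ℓ → ∃ i s1 s2, c0 * 4 ^ i ≤ 4 * I.cost ℓ ∧
    ∀ e, I.lo ℓ ≤ e → e ≤ I.hi ℓ → lev e ≤ i ∧ (sg i e = s1 ∨ sg i e = s2)

lemma exists_c0 (I : WPAPInstance n L) : ∃ c0 : ℝ, 0 < c0 ∧ ∀ ℓ, 0 < I.cost ℓ → c0 ≤ I.cost ℓ := by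
  by_cases h : (Finset.univ.filter fun ℓ => 0 < I.cost ℓ).Nonempty
  · obtain ⟨m, hm, hm2⟩ := Finset.exists_min_image _ I.cost h
    simp only [Finset.mem_filter, Finset.mem_univ, true_and] at hm hm2
    exact ⟨_, hm, hm2⟩
  · refine ⟨1, one_pos, fun ℓ hl => absurd ⟨ℓ, by simpa using hl⟩ h⟩

lemma exists_level (c0 : ℝ) (h0 : 0 < c0) (x : ℝ) : ∃ i : ℕ, x ≤ c0 * 4 ^ i := by
  obtain ⟨i, hi⟩ := pow_unbounded_of_one_lt (x / c0) (by norm_num : (1 : ℝ) < 4)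
  exact ⟨i, by rw [div_lt_iff₀ h0] at hi; linarith⟩

lemma exists_T (I : WPAPInstance n L) (c0 : ℝ) (h0 : 0 < c0) (lev : Fin n → ℕ)
    (hlev : ∀ e, ∃ ℓ, (I.lo ℓ ≤ e ∧ e ≤ I.hi ℓ) ∧ I.cost ℓ ≤ c0 * 4 ^ lev e) (i s : ℕ) :
    ∃ T : Finset L, I.setCost T ≤ 3 * (c0 * 4 ^ i) ∧ ∀ e : Fin n, lev e ≤ i →
      seg I c0 (i + 1) e = s → ∃ ℓ ∈ T, I.lo ℓ ≤ e ∧ e ≤ I.hi ℓ := by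
  have hp : 0 < c0 * 4 ^ i := by positivity
  by_cases h : (Finset.univ.filter fun e : Fin n => lev e ≤ i ∧ seg I c0 (i + 1) e = s).Nonempty
  · obtain ⟨m, hm, hm2⟩ := Finset.exists_max_image _ id h
    simp only [Finset.mem_filter, Finset.mem_univ, true_and, id] at hm hm2
    have e1 : 3 * (c0 * 4 ^ (i + 1)) / 4 = 3 * (c0 * 4 ^ i) := by ring
    have h3 := seg_cov I c0 h0 (i + 1) m
    rw [hm.2, e1] at h3
    rcases h3 with ⟨T, hT, hT2⟩ | h3
    · refine ⟨T, hT2, fun e h4 h5 => hT e ?_ (hm2 e ⟨h4, h5⟩)⟩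
      rw [← h5]; exact seg_le _ _ _ _
    · obtain ⟨ℓ, h6, h7⟩ := hlev m
      refine ⟨{ℓ}, ?_, fun e h4 h5 => ?_⟩
      · simp only [WPAPInstance.setCost, Finset.sum_singleton]
        have : c0 * 4 ^ lev m ≤ c0 * 4 ^ i := by
          gcongr
          · norm_num
          · exact hm.1
        linarith
      · have h8 : e = m := by
          apply le_antisymm (hm2 e ⟨h4, h5⟩)
          have := seg_le I c0 (i + 1) e
          rw [h5, h3] at this
          exact this
        exact ⟨ℓ, by simp, h8 ▸ h6⟩
  · refine ⟨∅, by simp only [WPAPInstance.setCost, Finset.sum_empty]; linarith, fun e h4 h5 => absurd ⟨e, by simp [h4, h5]⟩ h⟩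

open Classical in
lemma exists_lam (I : WPAPInstance n L) : Nonempty (Lam I) := by
  obtain ⟨c0, h0, hc⟩ := exists_c0 I
  have hex : ∀ e : Fin n, ∃ i : ℕ, ∃ ℓ, (I.lo ℓ ≤ e ∧ e ≤ I.hi ℓ) ∧ I.cost ℓ ≤ c0 * 4 ^ i := by
    intro e
    obtain ⟨ℓ, hl⟩ := I.covered e
    obtain ⟨i, hi⟩ := exists_level c0 h0 (I.cost ℓ)
    exact ⟨i, ℓ, hl, hi⟩
  choose T hT1 hT2 using exists_T I c0 h0 (fun e => Nat.find (hex e)) (fun e => Nat.find_spec (hex e))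
  refine ⟨⟨c0, h0, fun i e => seg I c0 (i + 1) e, fun e => Nat.find (hex e), T, ?_, ?_, hT1, ?_, ?_⟩⟩
  · intro i e
    exact (seg_le _ _ _ _).trans_lt e.2
  · intro i e e' h
    change greedy _ (seg I c0 (i + 1) e) = greedy _ (seg I c0 (i + 1) e')
    rw [h]
  · intro i e h
    exact hT2 i _ e h rfl
  · intro ℓ hl
    have hx := exists_level c0 h0 (I.cost ℓ)
    obtain ⟨s1, s2, hs⟩ := seg_two I c0 h0 (Nat.find hx) ℓ (Nat.find_spec hx)
    refine ⟨Nat.find hx, s1, s2, ?_, fun e h1 h2 => ⟨?_, hs e h1 h2⟩⟩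
    · rcases hk : Nat.find hx with _ | k
      · have := hc ℓ hl
        simp; linarith
      · have := Nat.find_min hx (m := k) (by omega)
        rw [pow_succ]
        push Not at this
        linarith
    · exact Nat.find_min' _ ⟨ℓ, ⟨h1, h2⟩, Nat.find_spec hx⟩

def KK (t : ℕ) : ℕ := Nat.log 2 t + 1

def zer (I : WPAPInstance n L) (e : Fin n) : Prop :=
  ∃ ℓ, (I.lo ℓ ≤ e ∧ e ≤ I.hi ℓ) ∧ I.cost ℓ = 0

open Classical in
noncomputable def qq {I : WPAPInstance n L} (Λ : Lam I) : List (Fin n) → ℕ → ℕ → ℚ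
  | [] => fun _ _ => 0
  | e :: l => fun i s =>
    if (¬ zer I e ∧ ¬ ∃ k < KK (l.length + 1), qq Λ l (Λ.lev e + k) (Λ.sg (Λ.lev e + k) e) = 1) ∧
      (Λ.lev e ≤ i ∧ i < Λ.lev e + KK (l.length + 1) ∧ s = Λ.sg i e) then
      if i = Λ.lev e then 1 else
        min 1 (qq Λ l i s + (qq Λ l i s + 1 / KK (l.length + 1)) / 4 ^ (i - Λ.lev e))
    else qq Λ l i s

/-- the request `e` after `l` (reversed history) triggers an update -/
def upd {I : WPAPInstance n L} (Λ : Lam I) (e : Fin n) (l : List (Fin n)) : Prop :=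
  ¬ zer I e ∧ ¬ ∃ k < KK (l.length + 1), qq Λ l (Λ.lev e + k) (Λ.sg (Λ.lev e + k) e) = 1

variable {I : WPAPInstance n L} (Λ : Lam I)

lemma KK_pos (t : ℕ) : 0 < KK t := Nat.succ_pos _

lemma qq_nonneg (l : List (Fin n)) (i s : ℕ) : 0 ≤ qq Λ l i s := by
  induction l generalizing i s with
  | nil => simp [qq]
  | cons e l ih =>
    have := ih i s
    simp only [qq]
    split_ifs
    · norm_num
    · positivity
    · exact this

lemma qq_le_one (l : List (Fin n)) (i s : ℕ) : qq Λ l i s ≤ 1 := by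
  induction l generalizing i s with
  | nil => simp [qq]
  | cons e l ih =>
    have := ih i s
    simp only [qq]
    split_ifs
    · norm_num
    · exact min_le_left _ _
    · exact this

lemma qq_not_upd {e : Fin n} {l : List (Fin n)} (h : ¬ upd Λ e l) : qq Λ (e :: l) = qq Λ l := by
  funext i s
  simp only [qq]
  rw [if_neg]
  exact fun h2 => h h2.1

lemma qq_off {e : Fin n} {l : List (Fin n)} {i s : ℕ}
    (h : ¬ (Λ.lev e ≤ i ∧ i < Λ.lev e + KK (l.length + 1) ∧ s = Λ.sg i e)) :
    qq Λ (e :: l) i s = qq Λ l i s := by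
  simp only [qq]
  rw [if_neg]
  exact fun h2 => h h2.2

lemma qq_upd_lev {e : Fin n} {l : List (Fin n)} (h : upd Λ e l) :
    qq Λ (e :: l) (Λ.lev e) (Λ.sg (Λ.lev e) e) = 1 := by
  simp only [qq]
  rw [if_pos, if_pos trivial]
  exact ⟨h, le_rfl, by have := KK_pos (l.length + 1); omega, rfl⟩

lemma qq_upd {e : Fin n} {l : List (Fin n)} (h : upd Λ e l) {i : ℕ} (h1 : Λ.lev e < i)
    (h2 : i < Λ.lev e + KK (l.length + 1)) :
    qq Λ (e :: l) i (Λ.sg i e) = min 1 (qq Λ l i (Λ.sg i e) +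
      (qq Λ l i (Λ.sg i e) + 1 / KK (l.length + 1)) / 4 ^ (i - Λ.lev e)) := by
  simp only [qq]
  rw [if_pos, if_neg h1.ne']
  exact ⟨h, h1.le, h2, rfl⟩

lemma qq_mono (e : Fin n) (l : List (Fin n)) (i s : ℕ) : qq Λ l i s ≤ qq Λ (e :: l) i s := by
  have h0 := qq_nonneg Λ l i s
  have h1 := qq_le_one Λ l i s
  simp only [qq]
  split_ifs
  · exact h1
  · apply le_min h1
    have : 0 ≤ (qq Λ l i s + 1 / (KK (l.length + 1) : ℚ)) / 4 ^ (i - Λ.lev e) := by positivity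
    linarith
  · exact le_rfl

/-- increment bound: `w_i (q' - q) ≤ β (q' + 1/K)` -/
lemma qq_inc (e : Fin n) (l : List (Fin n)) (k : ℕ) (hk : k < KK (l.length + 1)) :
    (4 : ℚ) ^ k * (qq Λ (e :: l) (Λ.lev e + k) (Λ.sg (Λ.lev e + k) e) -
      qq Λ l (Λ.lev e + k) (Λ.sg (Λ.lev e + k) e)) ≤
      qq Λ (e :: l) (Λ.lev e + k) (Λ.sg (Λ.lev e + k) e) + 1 / KK (l.length + 1) := by
  have hK : (0 : ℚ) < 1 / KK (l.length + 1) := by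
    have := KK_pos (l.length + 1)
    positivity
  have hm := qq_mono Λ e l (Λ.lev e + k) (Λ.sg (Λ.lev e + k) e)
  have h0 := qq_nonneg Λ l (Λ.lev e + k) (Λ.sg (Λ.lev e + k) e)
  by_cases h : upd Λ e l
  · rcases Nat.eq_zero_or_pos k with rfl | hk0
    · simp only [pow_zero, one_mul]
      linarith
    · have h2 := qq_upd Λ h (i := Λ.lev e + k) (by omega) (by omega)
      rw [Nat.add_sub_cancel_left] at h2
      have h3 := h2.le.trans (min_le_right _ _)
      set a := qq Λ (e :: l) (Λ.lev e + k) (Λ.sg (Λ.lev e + k) e)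
      set b := qq Λ l (Λ.lev e + k) (Λ.sg (Λ.lev e + k) e)
      have h4 : a - b ≤ (b + 1 / (KK (l.length + 1) : ℚ)) / 4 ^ k := by linarith
      rw [le_div_iff₀ (by positivity)] at h4
      linarith
  · rw [qq_not_upd Λ h]
    simp only [sub_self, mul_zero]
    positivity

section alg

variable (M : ℕ) (S : Finset (ℕ × ℕ))

noncomputable def QQ (l : List (Fin n)) (i s : ℕ) : ℕ := ⌊(M : ℚ) * qq Λ l i s⌋₊

def thr (θ : S → Fin M) (i s : ℕ) : ℕ := if h : (i, s) ∈ S then (θ ⟨(i, s), h⟩ : ℕ) else 0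

/-- no higher active node in the window -/
def FF (e : Fin n) (l : List (Fin n)) (k : ℕ) (θ : S → Fin M) : Prop :=
  ∀ k', k < k' → k' < KK (l.length + 1) →
    QQ Λ M (e :: l) (Λ.lev e + k') (Λ.sg (Λ.lev e + k') e) ≤ thr M S θ (Λ.lev e + k') (Λ.sg (Λ.lev e + k') e)

def buy (e : Fin n) (l : List (Fin n)) (k : ℕ) (θ : S → Fin M) : Prop :=
  FF Λ M S e l k θ ∧
  QQ Λ M l (Λ.lev e + k) (Λ.sg (Λ.lev e + k) e) ≤ thr M S θ (Λ.lev e + k) (Λ.sg (Λ.lev e + k) e) ∧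
  thr M S θ (Λ.lev e + k) (Λ.sg (Λ.lev e + k) e) < QQ Λ M (e :: l) (Λ.lev e + k) (Λ.sg (Λ.lev e + k) e)

open Classical in
noncomputable def step (e : Fin n) (l : List (Fin n)) (θ : S → Fin M) : Finset L :=
  if h : zer I e then {h.choose} else
    (Finset.range (KK (l.length + 1))).biUnion fun k =>
      if buy Λ M S e l k θ then Λ.T (Λ.lev e + k) (Λ.sg (Λ.lev e + k) e) else ∅

noncomputable def alg (θ : S → Fin M) : List (Fin n) → Finset L
  | [] => ∅
  | e :: l => alg θ l ∪ step Λ M S e l θ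

lemma lam_le {i j : ℕ} (hij : i ≤ j) {e e' : Fin n} (h : Λ.sg i e = Λ.sg i e') :
    Λ.sg j e = Λ.sg j e' := by
  induction j, hij using Nat.le_induction with
  | base => exact h
  | succ j hj ih => exact Λ.lam _ _ _ ih

lemma thr_lt (hM : 0 < M) (θ : S → Fin M) (i s : ℕ) : thr M S θ i s < M := by
  unfold thr; split_ifs
  · exact Fin.is_lt _
  · exact hM

lemma alg_inv (θ : S → Fin M) (l : List (Fin n)) :
    ∀ i s, thr M S θ i s < QQ Λ M l i s → ∀ e, Λ.lev e ≤ i → Λ.sg i e = s →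
      ∃ ℓ ∈ alg Λ M S θ l, I.lo ℓ ≤ e ∧ e ≤ I.hi ℓ := by
  induction l with
  | nil => intro i s h; simp [QQ, qq] at h
  | cons e l ih =>
    have ih' : ∀ i s, thr M S θ i s < QQ Λ M l i s → ∀ e', Λ.lev e' ≤ i → Λ.sg i e' = s →
      ∃ ℓ ∈ alg Λ M S θ (e :: l), I.lo ℓ ≤ e' ∧ e' ≤ I.hi ℓ := by
      intro i s h e' h1 h2
      obtain ⟨ℓ, h3, h4⟩ := ih i s h e' h1 h2
      exact ⟨ℓ, Finset.mem_union_left _ h3, h4⟩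
    intro i s h e' h1 h2
    by_cases hold : thr M S θ i s < QQ Λ M l i s
    · exact ih' i s hold e' h1 h2
    have hne : qq Λ (e :: l) i s ≠ qq Λ l i s := by
      intro h3; unfold QQ at h hold; rw [h3] at h; exact hold h
    have hu : upd Λ e l := by
      by_contra hu; rw [qq_not_upd Λ hu] at hne; exact hne rfl
    have hw : Λ.lev e ≤ i ∧ i < Λ.lev e + KK (l.length + 1) ∧ s = Λ.sg i e := by
      by_contra hw; exact hne (qq_off Λ hw)
    obtain ⟨w1, w2, w3⟩ := hw
    -- top active level
    classical
    let A := (Finset.range (KK (l.length + 1))).filter fun k =>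
      thr M S θ (Λ.lev e + k) (Λ.sg (Λ.lev e + k) e) < QQ Λ M (e :: l) (Λ.lev e + k) (Λ.sg (Λ.lev e + k) e)
    have hmem : i - Λ.lev e ∈ A := by
      simp only [A, Finset.mem_filter, Finset.mem_range]
      rw [Nat.add_sub_cancel' w1, ← w3]
      exact ⟨by omega, h⟩
    obtain ⟨k, hkA, hkmax⟩ := Finset.exists_max_image A id ⟨_, hmem⟩
    have hik := hkmax _ hmem
    simp only [id] at hik hkmax
    simp only [A, Finset.mem_filter, Finset.mem_range] at hkA hkmax
    have hsame : Λ.sg (Λ.lev e + k) e' = Λ.sg (Λ.lev e + k) e :=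
      lam_le Λ (i := i) (by omega) (by rw [h2, w3])
    by_cases hk : thr M S θ (Λ.lev e + k) (Λ.sg (Λ.lev e + k) e) < QQ Λ M l (Λ.lev e + k) (Λ.sg (Λ.lev e + k) e)
    · exact ih' _ _ hk e' (by omega) hsame
    · have hb : buy Λ M S e l k θ := by
        refine ⟨fun k' h3 h4 => ?_, by omega, hkA.2⟩
        by_contra h5
        have := hkmax k' ⟨h4, by omega⟩
        omega
      obtain ⟨ℓ, h3, h4⟩ := Λ.T_cov (Λ.lev e + k) e' (by omega)
      refine ⟨ℓ, Finset.mem_union_right _ ?_, h4⟩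
      unfold step
      rw [dif_neg hu.1]
      refine Finset.mem_biUnion.2 ⟨k, Finset.mem_range.2 hkA.1, ?_⟩
      rw [if_pos hb, ← hsame]
      exact h3

lemma alg_cov (hM : 0 < M) (θ : S → Fin M) (l : List (Fin n)) :
    ∀ e ∈ l, ∃ ℓ ∈ alg Λ M S θ l, I.lo ℓ ≤ e ∧ e ≤ I.hi ℓ := by
  induction l with
  | nil => simp
  | cons e l ih =>
    intro e' he'
    rcases List.mem_cons.1 he' with rfl | h
    swap
    · obtain ⟨ℓ, h3, h4⟩ := ih e' h
      exact ⟨ℓ, Finset.mem_union_left _ h3, h4⟩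
    by_cases hz : zer I e'
    · refine ⟨hz.choose, Finset.mem_union_right _ ?_, hz.choose_spec.1⟩
      unfold step
      rw [dif_pos hz]; simp
    have key : ∃ k < KK (l.length + 1), qq Λ (e' :: l) (Λ.lev e' + k) (Λ.sg (Λ.lev e' + k) e') = 1 := by
      by_cases hu : upd Λ e' l
      · exact ⟨0, KK_pos _, qq_upd_lev Λ hu⟩
      · rw [qq_not_upd Λ hu]
        by_contra h
        exact hu ⟨hz, h⟩
    obtain ⟨k, hk, h1⟩ := key
    refine alg_inv Λ M S θ (e' :: l) (Λ.lev e' + k) _ ?_ e' (by omega) rfl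
    unfold QQ
    rw [h1, mul_one, Nat.floor_natCast]
    exact thr_lt M S hM θ _ _

end alg

lemma card_fin_Ico (M a b : ℕ) (hb : b ≤ M) :
    (@Finset.filter (Fin M) (fun x : Fin M => a ≤ (x : ℕ) ∧ (x : ℕ) < b)
      (fun _ => Classical.propDecidable _) Finset.univ).card = b - a := by
  rw [← Nat.card_Ico, ← Finset.card_image_of_injective _ Fin.val_injective]
  congr 1
  ext y
  simp only [Finset.mem_image, Finset.mem_filter, Finset.mem_univ, true_and, Finset.mem_Ico]
  constructor
  · rintro ⟨x, hx, rfl⟩; exact hx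
  · intro hy; exact ⟨⟨y, by omega⟩, hy, rfl⟩

open Classical in
lemma count_indep {V : Type} [Fintype V] [DecidableEq V] {M : ℕ} (v : V) (F : (V → Fin M) → Prop)
    (hF : ∀ θ x, F (Function.update θ v x) ↔ F θ) :
    ∃ N : ℕ, ∀ p : Fin M → Prop, (Finset.univ.filter fun θ : V → Fin M => F θ ∧ p (θ v)).card =
      (Finset.univ.filter p).card * N := by
  rcases Nat.eq_zero_or_pos M with rfl | hM
  · refine ⟨0, fun p => ?_⟩
    rw [mul_zero, Finset.card_eq_zero]
    ext θ
    exact (θ v).elim0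
  · let x0 : Fin M := ⟨0, hM⟩
    refine ⟨(Finset.univ.filter fun θ : V → Fin M => F θ ∧ θ v = x0).card, fun p => ?_⟩
    rw [Finset.card_eq_sum_card_fiberwise (f := fun θ : V → Fin M => θ v) (t := Finset.univ.filter p)]
    · rw [← smul_eq_mul, ← Finset.sum_const]
      refine Finset.sum_congr rfl fun x hx => ?_
      refine Finset.card_bij' (fun θ _ => Function.update θ v x0) (fun θ _ => Function.update θ v x) ?_ ?_ ?_ ?_
      · intro θ hθ
        simp only [Finset.mem_filter, Finset.mem_univ, true_and] at hθ ⊢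
        simp [hF, hθ.1.1]
      · intro θ hθ
        simp only [Finset.mem_filter, Finset.mem_univ, true_and] at hθ hx ⊢
        simp [hF, hθ.1, hx]
      · intro θ hθ
        simp only [Finset.mem_filter, Finset.mem_univ, true_and] at hθ ⊢
        rw [← hθ.2]; simp
      · intro θ hθ
        simp only [Finset.mem_filter, Finset.mem_univ, true_and] at hθ ⊢
        rw [← hθ.2]; simp
    · intro θ hθ
      simp only [Finset.coe_filter, Finset.mem_univ, true_and, Set.mem_ofPred_eq] at hθ ⊢
      exact hθ.2

lemma setCost_biUnion_le (I : WPAPInstance n L) (s : Finset ℕ) (f : ℕ → Finset L) :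
    I.setCost (s.biUnion f) ≤ ∑ k ∈ s, I.setCost (f k) := by
  induction s using Finset.induction_on with
  | empty => simp [WPAPInstance.setCost]
  | insert a s ha ih =>
    rw [Finset.biUnion_insert, Finset.sum_insert ha]
    linarith [setCost_union_le I (f a) (s.biUnion f)]

section cost
variable (M : ℕ) (S : Finset (ℕ × ℕ))

lemma QQ_le (l : List (Fin n)) (i s : ℕ) : QQ Λ M l i s ≤ M := by
  unfold QQ
  apply Nat.floor_le_of_le
  have := qq_le_one Λ l i s
  nlinarith [(Nat.cast_nonneg M : (0 : ℚ) ≤ M)]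

open Classical in
lemma exists_N (e : Fin n) (l : List (Fin n)) (k : ℕ)
    (hS : (Λ.lev e + k, Λ.sg (Λ.lev e + k) e) ∈ S) :
    ∃ N : ℕ, (Finset.univ.filter fun θ : S → Fin M => buy Λ M S e l k θ).card =
        (QQ Λ M (e :: l) (Λ.lev e + k) (Λ.sg (Λ.lev e + k) e) -
          QQ Λ M l (Λ.lev e + k) (Λ.sg (Λ.lev e + k) e)) * N ∧
      (Finset.univ.filter fun θ : S → Fin M => FF Λ M S e l k θ ∧
        thr M S θ (Λ.lev e + k) (Λ.sg (Λ.lev e + k) e) <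
          QQ Λ M (e :: l) (Λ.lev e + k) (Λ.sg (Λ.lev e + k) e)).card =
        QQ Λ M (e :: l) (Λ.lev e + k) (Λ.sg (Λ.lev e + k) e) * N ∧
      M * N ≤ Fintype.card (S → Fin M) := by
  obtain ⟨N, hN⟩ := count_indep (M := M) (⟨_, hS⟩ : S) (FF Λ M S e l k) (by
    intro θ x
    unfold FF
    refine forall_congr' fun k' => forall_congr' fun h1 => forall_congr' fun h2 => ?_
    have : thr M S (Function.update θ ⟨_, hS⟩ x) (Λ.lev e + k') (Λ.sg (Λ.lev e + k') e) =
        thr M S θ (Λ.lev e + k') (Λ.sg (Λ.lev e + k') e) := by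
      unfold thr
      split_ifs with h
      · rw [Function.update_of_ne]
        intro h3
        simp only [Subtype.mk.injEq, Prod.mk.injEq] at h3
        omega
      · rfl
    rw [this])
  have hthr : ∀ θ : S → Fin M, thr M S θ (Λ.lev e + k) (Λ.sg (Λ.lev e + k) e) = (θ ⟨_, hS⟩ : ℕ) := by
    intro θ; unfold thr; rw [dif_pos hS]
  have hQ' := QQ_le Λ M (e :: l) (Λ.lev e + k) (Λ.sg (Λ.lev e + k) e)
  refine ⟨N, ?_, ?_, ?_⟩
  · have := hN fun x => QQ Λ M l (Λ.lev e + k) (Λ.sg (Λ.lev e + k) e) ≤ (x : ℕ) ∧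
      (x : ℕ) < QQ Λ M (e :: l) (Λ.lev e + k) (Λ.sg (Λ.lev e + k) e)
    rw [card_fin_Ico _ _ _ hQ'] at this
    rw [← this]
    congr 1
    ext θ
    simp only [buy, hthr, Finset.mem_filter, Finset.mem_univ, true_and]
  · have := hN fun x => 0 ≤ (x : ℕ) ∧
      (x : ℕ) < QQ Λ M (e :: l) (Λ.lev e + k) (Λ.sg (Λ.lev e + k) e)
    rw [card_fin_Ico _ _ _ hQ', Nat.sub_zero] at this
    rw [← this]
    congr 1
    ext θ
    simp only [hthr, Nat.zero_le, true_and]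
  · have := hN fun x => 0 ≤ (x : ℕ) ∧ (x : ℕ) < M
    rw [card_fin_Ico _ _ _ le_rfl, Nat.sub_zero] at this
    rw [← this]
    exact Finset.card_le_univ _

open Classical in
lemma step_cost (e : Fin n) (l : List (Fin n))
    (hS : ∀ k < KK (l.length + 1), (Λ.lev e + k, Λ.sg (Λ.lev e + k) e) ∈ S)
    (hQ : ∀ k < KK (l.length + 1), (QQ Λ M l (Λ.lev e + k) (Λ.sg (Λ.lev e + k) e) : ℚ) =
      M * qq Λ l (Λ.lev e + k) (Λ.sg (Λ.lev e + k) e))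
    (hQ' : ∀ k < KK (l.length + 1), (QQ Λ M (e :: l) (Λ.lev e + k) (Λ.sg (Λ.lev e + k) e) : ℚ) =
      M * qq Λ (e :: l) (Λ.lev e + k) (Λ.sg (Λ.lev e + k) e)) :
    ∑ θ : S → Fin M, I.setCost (step Λ M S e l θ) ≤
      Fintype.card (S → Fin M) * (6 * if upd Λ e l then Λ.c0 * 4 ^ Λ.lev e else 0) := by
  have hc0 := Λ.c0_pos
  by_cases hu : upd Λ e l
  swap
  · rw [if_neg hu, mul_zero, mul_zero]
    apply le_of_eq
    refine Finset.sum_eq_zero fun θ _ => ?_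
    unfold step
    split_ifs with hz
    · simp [WPAPInstance.setCost, hz.choose_spec.2]
    · have : ∀ k, ¬ buy Λ M S e l k θ := by
        intro k hk
        have h1 := hk.2.1
        have h2 := hk.2.2
        unfold QQ at h1 h2
        rw [qq_not_upd Λ hu] at h2
        omega
      have h0 : ((Finset.range (KK (l.length + 1))).biUnion fun k =>
          if buy Λ M S e l k θ then Λ.T (Λ.lev e + k) (Λ.sg (Λ.lev e + k) e) else ∅) = ∅ := by
        ext x; simp [this]
      rw [h0]; simp [WPAPInstance.setCost]
  rw [if_pos hu]
  set K := KK (l.length + 1) with hK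
  set β := Λ.c0 * 4 ^ Λ.lev e with hβ
  have hβ0 : 0 < β := by positivity
  have hKpos : (0 : ℝ) < K := by exact_mod_cast KK_pos _
  choose! N hN1 hN2 hN3 using fun k (hk : k < K) => exists_N Λ M S e l k (hS k hk)
  set Ω := Fintype.card (S → Fin M)
  have hstep : ∀ θ : S → Fin M, I.setCost (step Λ M S e l θ) ≤
      ∑ k ∈ Finset.range K, if buy Λ M S e l k θ then 3 * (Λ.c0 * 4 ^ (Λ.lev e + k)) else 0 := by
    intro θ
    unfold step
    rw [dif_neg hu.1]
    refine (setCost_biUnion_le I _ _).trans (Finset.sum_le_sum fun k _ => ?_)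
    split_ifs
    · exact Λ.T_cost _ _
    · simp [WPAPInstance.setCost]
  refine (Finset.sum_le_sum fun θ _ => hstep θ).trans ?_
  rw [Finset.sum_comm]
  have hdisj : ∑ k ∈ Finset.range K, QQ Λ M (e :: l) (Λ.lev e + k) (Λ.sg (Λ.lev e + k) e) * N k ≤ Ω := by
    rw [Finset.sum_congr rfl fun k hk => (hN2 k (Finset.mem_range.1 hk)).symm, ← Finset.card_biUnion]
    · exact Finset.card_le_univ _
    · have aux : ∀ k ∈ Finset.range K, ∀ k' ∈ Finset.range K, k < k' → Disjoint
          (Finset.univ.filter fun θ : S → Fin M => FF Λ M S e l k θ ∧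
            thr M S θ (Λ.lev e + k) (Λ.sg (Λ.lev e + k) e) <
            QQ Λ M (e :: l) (Λ.lev e + k) (Λ.sg (Λ.lev e + k) e))
          (Finset.univ.filter fun θ : S → Fin M => FF Λ M S e l k' θ ∧
            thr M S θ (Λ.lev e + k') (Λ.sg (Λ.lev e + k') e) <
            QQ Λ M (e :: l) (Λ.lev e + k') (Λ.sg (Λ.lev e + k') e)) := by
        intro k hk k' hk' hlt
        rw [Finset.disjoint_left]
        intro θ h1 h2
        simp only [Finset.mem_filter, Finset.mem_univ, true_and] at h1 h2
        have := h1.1 k' hlt (Finset.mem_range.1 hk')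
        omega
      intro k hk k' hk' hne
      rcases lt_or_gt_of_ne hne with h | h
      · exact aux k hk k' hk' h
      · exact (aux k' hk' k hk h).symm
  have hterm : ∀ k ∈ Finset.range K, (∑ θ : S → Fin M,
      if buy Λ M S e l k θ then 3 * (Λ.c0 * 4 ^ (Λ.lev e + k)) else 0) ≤
      3 * β * (((QQ Λ M (e :: l) (Λ.lev e + k) (Λ.sg (Λ.lev e + k) e) * N k : ℕ) : ℝ) + Ω / K) := by
    intro k hk
    have hk := Finset.mem_range.1 hk
    rw [← Finset.sum_filter, Finset.sum_const, hN1 k hk, nsmul_eq_mul]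
    have h1 := qq_inc Λ e l k hk
    have hmono : QQ Λ M l (Λ.lev e + k) (Λ.sg (Λ.lev e + k) e) ≤
        QQ Λ M (e :: l) (Λ.lev e + k) (Λ.sg (Λ.lev e + k) e) := by
      unfold QQ
      apply Nat.floor_le_floor
      have := qq_mono Λ e l (Λ.lev e + k) (Λ.sg (Λ.lev e + k) e)
      gcongr
    have h2 : (4 : ℚ) ^ k * ((QQ Λ M (e :: l) (Λ.lev e + k) (Λ.sg (Λ.lev e + k) e) : ℚ) -
        QQ Λ M l (Λ.lev e + k) (Λ.sg (Λ.lev e + k) e)) ≤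
        QQ Λ M (e :: l) (Λ.lev e + k) (Λ.sg (Λ.lev e + k) e) + M / K := by
      rw [hQ k hk, hQ' k hk]
      have h3 := mul_le_mul_of_nonneg_left h1 (Nat.cast_nonneg M : (0 : ℚ) ≤ M)
      calc _ = _ := by ring
        _ ≤ _ := h3
        _ = _ := by ring
    have h2r : (4 : ℝ) ^ k * ((QQ Λ M (e :: l) (Λ.lev e + k) (Λ.sg (Λ.lev e + k) e) : ℝ) -
        QQ Λ M l (Λ.lev e + k) (Λ.sg (Λ.lev e + k) e)) ≤
        QQ Λ M (e :: l) (Λ.lev e + k) (Λ.sg (Λ.lev e + k) e) + M / K := by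
      have := (Rat.cast_le (K := ℝ)).2 h2
      push_cast at this
      exact this
    have h4 : ((M : ℝ) * N k) / K ≤ Ω / K := by
      gcongr
      exact_mod_cast hN3 k hk
    push_cast [Nat.cast_sub hmono]
    generalize (QQ Λ M (e :: l) (Λ.lev e + k) (Λ.sg (Λ.lev e + k) e) : ℝ) = a at *
    generalize (QQ Λ M l (Λ.lev e + k) (Λ.sg (Λ.lev e + k) e) : ℝ) = b at *
    have hNn : (0 : ℝ) ≤ N k := Nat.cast_nonneg _
    calc (a - b) * (N k : ℝ) * (3 * (Λ.c0 * 4 ^ (Λ.lev e + k)))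
        = 3 * β * ((4 ^ k * (a - b)) * N k) := by rw [hβ, pow_add]; ring
      _ ≤ 3 * β * ((a + M / K) * N k) := by gcongr
      _ = 3 * β * (a * N k + (M * N k) / K) := by ring
      _ ≤ 3 * β * (a * N k + Ω / K) := by gcongr
  refine (Finset.sum_le_sum hterm).trans ?_
  rw [← Finset.mul_sum, Finset.sum_add_distrib, ← Nat.cast_sum, Finset.sum_const, Finset.card_range,
    nsmul_eq_mul, mul_div_cancel₀ _ hKpos.ne']
  have : ((∑ k ∈ Finset.range K, QQ Λ M (e :: l) (Λ.lev e + k) (Λ.sg (Λ.lev e + k) e) * N k : ℕ) : ℝ) ≤ Ω := by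
    exact_mod_cast hdisj
  calc _ ≤ 3 * β * ((Ω : ℝ) + Ω) := by gcongr
    _ = _ := by ring

open Classical in
noncomputable def bsum : List (Fin n) → ℝ
  | [] => 0
  | e :: l => bsum l + if upd Λ e l then Λ.c0 * 4 ^ Λ.lev e else 0

lemma alg_cost (m : ℕ)
    (hS : ∀ (e : Fin n) (k : ℕ), k < KK m → (Λ.lev e + k, Λ.sg (Λ.lev e + k) e) ∈ S)
    (hQ : ∀ l : List (Fin n), l.length ≤ m → ∀ i s, (i, s) ∈ S → (QQ Λ M l i s : ℚ) = M * qq Λ l i s)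
    (l : List (Fin n)) (hl : l.length ≤ m) :
    ∑ θ : S → Fin M, I.setCost (alg Λ M S θ l) ≤ Fintype.card (S → Fin M) * (6 * bsum Λ l) := by
  induction l with
  | nil => simp [alg, bsum, WPAPInstance.setCost]
  | cons e l ih =>
    simp only [List.length_cons] at hl
    have h1 := ih (by omega)
    have hKm : KK (l.length + 1) ≤ KK m := by
      unfold KK; have := Nat.log_mono_right (b := 2) hl; omega
    have h2 := step_cost Λ M S e l (fun k hk => hS e k (by omega))
      (fun k hk => hQ l (by omega) _ _ (hS e k (by omega)))
      (fun k hk => hQ (e :: l) (by simpa using hl) _ _ (hS e k (by omega)))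
    have h3 : ∑ θ : S → Fin M, I.setCost (alg Λ M S θ (e :: l)) ≤
        ∑ θ : S → Fin M, I.setCost (alg Λ M S θ l) + ∑ θ : S → Fin M, I.setCost (step Λ M S e l θ) := by
      rw [← Finset.sum_add_distrib]
      exact Finset.sum_le_sum fun θ _ => setCost_union_le I _ _
    simp only [bsum]
    linarith

end cost

open Classical in
noncomputable def rs (i s : ℕ) : List (Fin n) → ℝ
  | [] => 0
  | e :: l => rs i s l + if upd Λ e l ∧ (Λ.lev e ≤ i ∧ i < Λ.lev e + KK (l.length + 1) ∧ s = Λ.sg i e)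
      then Λ.c0 * 4 ^ Λ.lev e else 0

open Classical in
noncomputable def bl (ℓ : L) : List (Fin n) → ℝ
  | [] => 0
  | e :: l => bl ℓ l + if upd Λ e l ∧ (I.lo ℓ ≤ e ∧ e ≤ I.hi ℓ) then Λ.c0 * 4 ^ Λ.lev e else 0

lemma KK_mono {a b : ℕ} (h : a ≤ b) : KK a ≤ KK b := by
  unfold KK; have := Nat.log_mono_right (b := 2) h; omega

lemma log_half {r : ℝ} (h0 : 0 ≤ r) (h1 : r ≤ 1) : r / 2 ≤ Real.log (1 + r) := by
  have h := Real.one_sub_inv_le_log_of_pos (x := 1 + r) (by linarith)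
  have : r / 2 ≤ 1 - (1 + r)⁻¹ := by
    have h3 : 1 - (1 + r)⁻¹ = r / (1 + r) := by field_simp; ring
    rw [h3]
    gcongr
    linarith
  linarith

open Classical in
lemma rs_le (m : ℕ) (i s : ℕ) (l : List (Fin n)) (hl : l.length ≤ m) :
    rs Λ i s l ≤ Λ.c0 * 4 ^ i * (2 * (Real.log ((qq Λ l i s : ℝ) + 1 / KK m) - Real.log (1 / KK m)) +
      if qq Λ l i s = 1 then 1 else 0) := by
  have hc0 := Λ.c0_pos
  have hR : (0 : ℝ) < 1 / KK m := by have := KK_pos m; positivity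
  have hw : 0 < Λ.c0 * 4 ^ i := by positivity
  induction l with
  | nil => simp [rs, qq]
  | cons e l ih =>
    simp only [List.length_cons] at hl
    have ih := ih (by omega)
    simp only [rs]
    by_cases hc : upd Λ e l ∧ (Λ.lev e ≤ i ∧ i < Λ.lev e + KK (l.length + 1) ∧ s = Λ.sg i e)
    swap
    · rw [if_neg hc, add_zero]
      have : qq Λ (e :: l) i s = qq Λ l i s := by
        by_cases hu : upd Λ e l
        · exact qq_off Λ fun h => hc ⟨hu, h⟩
        · rw [qq_not_upd Λ hu]
      rw [this]; exact ih
    · rw [if_pos hc]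
      obtain ⟨hu, h1, h2, rfl⟩ := hc
      have hq1 : qq Λ l i (Λ.sg i e) ≠ 1 := by
        intro h
        apply hu.2
        refine ⟨i - Λ.lev e, by omega, ?_⟩
        rw [Nat.add_sub_cancel' h1]; exact h
      rw [if_neg hq1] at ih
      have hm : (qq Λ l i (Λ.sg i e) : ℝ) ≤ qq Λ (e :: l) i (Λ.sg i e) := by
        exact_mod_cast qq_mono Λ e l i (Λ.sg i e)
      have hn : (0 : ℝ) ≤ qq Λ l i (Λ.sg i e) := by exact_mod_cast qq_nonneg Λ l i (Λ.sg i e)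
      by_cases hq' : qq Λ (e :: l) i (Λ.sg i e) = 1
      · rw [if_pos hq']
        have h3 : Real.log ((qq Λ l i (Λ.sg i e) : ℝ) + 1 / KK m) ≤
            Real.log ((qq Λ (e :: l) i (Λ.sg i e) : ℝ) + 1 / KK m) :=
          Real.log_le_log (by linarith) (by linarith)
        have h4 : Λ.c0 * 4 ^ Λ.lev e ≤ Λ.c0 * 4 ^ i := by
          gcongr
          · norm_num
        nlinarith [mul_le_mul_of_nonneg_left h3 hw.le]
      · rw [if_neg hq']
        have hne : Λ.lev e ≠ i := by
          rintro rfl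
          exact hq' (qq_upd_lev Λ hu)
        have h3 := qq_upd Λ hu (i := i) (by omega) h2
        have h4 : qq Λ (e :: l) i (Λ.sg i e) = qq Λ l i (Λ.sg i e) +
          (qq Λ l i (Λ.sg i e) + 1 / KK (l.length + 1)) / 4 ^ (i - Λ.lev e) := by
          rw [h3]
          apply min_eq_right
          by_contra h5
          rw [h3, min_eq_left (by linarith)] at hq'
          exact hq' rfl
        have h4r : (qq Λ (e :: l) i (Λ.sg i e) : ℝ) = qq Λ l i (Λ.sg i e) +
          (qq Λ l i (Λ.sg i e) + 1 / KK (l.length + 1)) / 4 ^ (i - Λ.lev e) := by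
          rw [h4]; push_cast; rfl
        have hKm : (1 : ℝ) / KK m ≤ 1 / KK (l.length + 1) := by
          have := KK_pos (l.length + 1)
          have h7 := KK_mono hl
          gcongr
        set r : ℝ := 1 / 4 ^ (i - Λ.lev e) with hr
        have hr0 : 0 < r := by positivity
        have hr1 : r ≤ 1 := by
          rw [hr, div_le_one (by positivity)]
          exact one_le_pow₀ (by norm_num)
        have h5 : ((qq Λ l i (Λ.sg i e) : ℝ) + 1 / KK m) * (1 + r) ≤ (qq Λ (e :: l) i (Λ.sg i e) : ℝ) + 1 / KK m := by
          have h8 : (qq Λ (e :: l) i (Λ.sg i e) : ℝ) = qq Λ l i (Λ.sg i e) +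
            (qq Λ l i (Λ.sg i e) + 1 / KK (l.length + 1)) * r := by rw [h4r, hr]; ring
          rw [h8]
          nlinarith
        have h6 := Real.log_le_log (by positivity) h5
        rw [Real.log_mul (by positivity) (by positivity)] at h6
        have h7 := log_half hr0.le hr1
        have h9 : Λ.c0 * 4 ^ Λ.lev e = Λ.c0 * 4 ^ i * r := by
          rw [hr, ← Nat.sub_add_cancel h1, pow_add, Nat.add_sub_cancel]
          field_simp
        rw [h9]
        have h10 : r ≤ 2 * (Real.log ((qq Λ (e :: l) i (Λ.sg i e) : ℝ) + 1 / KK m) -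
          Real.log ((qq Λ l i (Λ.sg i e) : ℝ) + 1 / KK m)) := by linarith
        nlinarith [mul_le_mul_of_nonneg_left h10 hw.le]

lemma rs_bound (m : ℕ) (i s : ℕ) (l : List (Fin n)) (hl : l.length ≤ m) :
    rs Λ i s l ≤ Λ.c0 * 4 ^ i * (2 * Real.log (KK m + 1) + 1) := by
  have hc0 := Λ.c0_pos
  have hK : (0 : ℝ) < KK m := by exact_mod_cast KK_pos m
  refine (rs_le Λ m i s l hl).trans ?_
  have hn : (0 : ℝ) ≤ qq Λ l i s := by exact_mod_cast qq_nonneg Λ l i s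
  have h1 : (qq Λ l i s : ℝ) ≤ 1 := by exact_mod_cast qq_le_one Λ l i s
  have h2 : Real.log ((qq Λ l i s : ℝ) + 1 / KK m) - Real.log (1 / KK m) ≤ Real.log (KK m + 1) := by
    rw [← Real.log_div (by positivity) (by positivity)]
    apply Real.log_le_log (by positivity)
    rw [div_le_iff₀ (by positivity)]
    have : ((KK m : ℝ) + 1) * (1 / KK m) = 1 + 1 / KK m := by field_simp
    rw [this]; linarith
  gcongr
  split_ifs <;> norm_num

lemma rs_step_nonneg (i s : ℕ) (e : Fin n) (l : List (Fin n)) : rs Λ i s l ≤ rs Λ i s (e :: l) := by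
  have hc0 := Λ.c0_pos
  simp only [rs]
  split_ifs
  · have : 0 < Λ.c0 * 4 ^ Λ.lev e := by positivity
    linarith
  · linarith

lemma bl_le (ℓ : L) (i s1 s2 : ℕ) (h : ∀ e, I.lo ℓ ≤ e → e ≤ I.hi ℓ →
      Λ.lev e ≤ i ∧ (Λ.sg i e = s1 ∨ Λ.sg i e = s2)) (l : List (Fin n)) :
    bl Λ ℓ l ≤ rs Λ i s1 l + rs Λ i s2 l + Λ.c0 * 4 ^ i * (1 - 1 / (l.length + 1)) := by
  have hc0 := Λ.c0_pos
  induction l with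
  | nil => simp [bl, rs]
  | cons e l ih =>
    have m1 := rs_step_nonneg Λ i s1 e l
    have m2 := rs_step_nonneg Λ i s2 e l
    have hw : 0 < Λ.c0 * 4 ^ i := by positivity
    have hx : (0 : ℝ) < (l.length : ℝ) + 1 := by positivity
    have h3 : 1 / (((e :: l).length : ℝ) + 1) ≤ 1 / ((l.length : ℝ) + 1) := by
      simp only [List.length_cons]; push_cast
      gcongr
      linarith
    have h3' := mul_le_mul_of_nonneg_left h3 hw.le
    by_cases hc : upd Λ e l ∧ (I.lo ℓ ≤ e ∧ e ≤ I.hi ℓ)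
    swap
    · simp only [bl]
      rw [if_neg hc]
      linarith
    · obtain ⟨h1, h2⟩ := h e hc.2.1 hc.2.2
      have hb : bl Λ ℓ (e :: l) = bl Λ ℓ l + Λ.c0 * 4 ^ Λ.lev e := by
        simp only [bl]; rw [if_pos hc]
      rw [hb]
      by_cases hwin : i < Λ.lev e + KK (l.length + 1)
      · rcases h2 with h2 | h2
        · have : rs Λ i s1 (e :: l) = rs Λ i s1 l + Λ.c0 * 4 ^ Λ.lev e := by
            simp only [rs]; rw [if_pos ⟨hc.1, h1, hwin, h2.symm⟩]
          linarith
        · have : rs Λ i s2 (e :: l) = rs Λ i s2 l + Λ.c0 * 4 ^ Λ.lev e := by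
            simp only [rs]; rw [if_pos ⟨hc.1, h1, hwin, h2.symm⟩]
          linarith
      · have h4 : Λ.c0 * 4 ^ Λ.lev e * 4 ^ KK (l.length + 1) ≤ Λ.c0 * 4 ^ i := by
          rw [mul_assoc, ← pow_add]
          gcongr
          · norm_num
          · omega
        have h5 : ((l.length : ℝ) + 2) ^ 2 ≤ 4 ^ KK (l.length + 1) := by
          have h6 := Nat.lt_pow_succ_log_self (b := 2) (by norm_num) (l.length + 1)
          have h7 : (l.length : ℝ) + 2 ≤ 2 ^ KK (l.length + 1) := by
            have : l.length + 2 ≤ 2 ^ KK (l.length + 1) := h6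
            exact_mod_cast this
          calc ((l.length : ℝ) + 2) ^ 2 ≤ (2 ^ KK (l.length + 1)) ^ 2 := by gcongr
            _ = 4 ^ KK (l.length + 1) := by rw [← pow_mul, mul_comm, pow_mul]; norm_num
        have h8 : Λ.c0 * 4 ^ Λ.lev e ≤ Λ.c0 * 4 ^ i * (1 / ((l.length : ℝ) + 1) - 1 / ((l.length : ℝ) + 2)) := by
          have h9 : Λ.c0 * 4 ^ Λ.lev e * ((l.length : ℝ) + 2) ^ 2 ≤ Λ.c0 * 4 ^ i :=
            (mul_le_mul_of_nonneg_left h5 (by positivity)).trans h4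
          have h10 : 1 / ((l.length : ℝ) + 2) ^ 2 ≤ 1 / ((l.length : ℝ) + 1) - 1 / ((l.length : ℝ) + 2) := by
            rw [div_sub_div _ _ (by positivity) (by positivity)]
            have : 1 * ((l.length : ℝ) + 2) - (l.length + 1) * 1 = 1 := by ring
            rw [this]
            apply one_div_le_one_div_of_le (by positivity)
            nlinarith
          calc Λ.c0 * 4 ^ Λ.lev e ≤ Λ.c0 * 4 ^ i * (1 / ((l.length : ℝ) + 2) ^ 2) := by
                rw [mul_one_div, le_div_iff₀ (by positivity)]; exact h9
            _ ≤ _ := by gcongr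
        have h11 : (((e :: l).length : ℝ) + 1) = (l.length : ℝ) + 2 := by
          simp only [List.length_cons]; push_cast; ring
        rw [h11]
        linarith

lemma bl_bound (m : ℕ) (ℓ : L) (l : List (Fin n)) (hl : l.length ≤ m) :
    bl Λ ℓ l ≤ I.cost ℓ * (16 * Real.log (KK m + 1) + 12) := by
  have hc0 := Λ.c0_pos
  have hlog : 0 ≤ Real.log ((KK m : ℝ) + 1) := Real.log_nonneg (by linarith [(Nat.cast_nonneg (KK m) : (0:ℝ) ≤ _)])
  rcases (I.cost_nonneg ℓ).eq_or_lt with h | h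
  · rw [← h, zero_mul]
    apply le_of_eq
    clear hl
    induction l with
    | nil => rfl
    | cons e l ih =>
      simp only [bl]
      rw [if_neg, ih, add_zero]
      rintro ⟨h1, h2⟩
      exact h1.1 ⟨ℓ, h2, h.symm⟩
  · obtain ⟨i, s1, s2, h1, h2⟩ := Λ.link ℓ h
    have h3 := bl_le Λ ℓ i s1 s2 h2 l
    have h4 := rs_bound Λ m i s1 l hl
    have h5 := rs_bound Λ m i s2 l hl
    have hw : 0 < Λ.c0 * 4 ^ i := by positivity
    have h6 : Λ.c0 * 4 ^ i * (1 - 1 / ((l.length : ℝ) + 1)) ≤ Λ.c0 * 4 ^ i * 1 := by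
      gcongr
      have : (0 : ℝ) ≤ 1 / ((l.length : ℝ) + 1) := by positivity
      linarith
    calc bl Λ ℓ l ≤ Λ.c0 * 4 ^ i * (4 * Real.log (KK m + 1) + 3) := by linarith
      _ ≤ 4 * I.cost ℓ * (4 * Real.log (KK m + 1) + 3) := by gcongr
      _ = _ := by ring

lemma bl_nonneg_step (ℓ : L) (e : Fin n) (l : List (Fin n)) : bl Λ ℓ l ≤ bl Λ ℓ (e :: l) := by
  have hc0 := Λ.c0_pos
  simp only [bl]
  split_ifs
  · have : 0 < Λ.c0 * 4 ^ Λ.lev e := by positivity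
    linarith
  · linarith

lemma bsum_le (T : Finset L) (l : List (Fin n))
    (hT : ∀ e ∈ l, ∃ ℓ ∈ T, I.lo ℓ ≤ e ∧ e ≤ I.hi ℓ) : bsum Λ l ≤ ∑ ℓ ∈ T, bl Λ ℓ l := by
  induction l with
  | nil => simp [bsum, bl]
  | cons e l ih =>
    have ih := ih fun e' he' => hT e' (List.mem_cons_of_mem _ he')
    by_cases hu : upd Λ e l
    · obtain ⟨ℓ, hℓ, hcov⟩ := hT e (by simp)
      have h1 : bl Λ ℓ (e :: l) = bl Λ ℓ l + Λ.c0 * 4 ^ Λ.lev e := by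
        simp only [bl]; rw [if_pos ⟨hu, hcov⟩]
      have h2 : bsum Λ (e :: l) = bsum Λ l + Λ.c0 * 4 ^ Λ.lev e := by
        simp only [bsum]; rw [if_pos hu]
      rw [h2]
      rw [← Finset.add_sum_erase _ _ hℓ, h1]
      rw [← Finset.add_sum_erase _ _ hℓ] at ih
      have : ∑ x ∈ T.erase ℓ, bl Λ x l ≤ ∑ x ∈ T.erase ℓ, bl Λ x (e :: l) :=
        Finset.sum_le_sum fun x _ => bl_nonneg_step Λ x e l
      linarith
    · have h2 : bsum Λ (e :: l) = bsum Λ l := by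
        simp only [bsum]; rw [if_neg hu, add_zero]
      rw [h2]
      exact ih.trans (Finset.sum_le_sum fun x _ => bl_nonneg_step Λ x e l)

lemma logKK (m : ℕ) : Real.log (KK m + 1) ≤ 1 + Real.log (1 + Real.log (1 + m)) := by
  have hx : 0 ≤ Real.log (1 + (m : ℝ)) := Real.log_nonneg (by linarith [(Nat.cast_nonneg m : (0:ℝ) ≤ _)])
  have h2 : Real.log 2 < 1 := by linarith [Real.log_two_lt_d9]
  have h2' : 1 / 2 < Real.log 2 := by linarith [Real.log_two_gt_d9]
  have h1 : (KK m : ℝ) + 1 ≤ 2 * (1 + Real.log (1 + m)) := by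
    have h3 : (Nat.log 2 m : ℝ) * Real.log 2 ≤ Real.log (1 + m) := by
      rw [← Real.log_pow]
      apply Real.log_le_log (by positivity)
      rcases Nat.eq_zero_or_pos m with rfl | hm
      · simp
      · have : 2 ^ Nat.log 2 m ≤ m := Nat.pow_log_le_self 2 hm.ne'
        have : (2 : ℝ) ^ Nat.log 2 m ≤ m := by exact_mod_cast this
        linarith
    have h4 : (KK m : ℝ) = Nat.log 2 m + 1 := by unfold KK; push_cast; rfl
    rw [h4]
    nlinarith [(Nat.cast_nonneg (Nat.log 2 m) : (0:ℝ) ≤ _)]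
  calc Real.log (KK m + 1) ≤ Real.log (2 * (1 + Real.log (1 + m))) :=
        Real.log_le_log (by positivity) h1
    _ = Real.log 2 + Real.log (1 + Real.log (1 + m)) := Real.log_mul (by norm_num) (by positivity)
    _ ≤ _ := by linarith

lemma bsum_opt (l : List (Fin n)) (T : Finset L) (hT : ∀ e ∈ l, ∃ ℓ ∈ T, I.lo ℓ ≤ e ∧ e ≤ I.hi ℓ) :
    6 * bsum Λ l ≤ 168 * (1 + Real.log (1 + Real.log (1 + (l.length : ℝ)))) * I.setCost T := by
  have h1 := bsum_le Λ T l hT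
  have h2 : ∑ ℓ ∈ T, bl Λ ℓ l ≤ ∑ ℓ ∈ T, I.cost ℓ * (16 * Real.log (KK l.length + 1) + 12) :=
    Finset.sum_le_sum fun ℓ _ => bl_bound Λ l.length ℓ l le_rfl
  rw [← Finset.sum_mul] at h2
  have h3 := logKK l.length
  have hx : 0 ≤ Real.log (1 + (l.length : ℝ)) := Real.log_nonneg (by linarith [(Nat.cast_nonneg l.length : (0:ℝ) ≤ _)])
  have hy : 0 ≤ Real.log (1 + Real.log (1 + (l.length : ℝ))) := Real.log_nonneg (by linarith)
  have hc : 0 ≤ I.setCost T := Finset.sum_nonneg fun _ _ => I.cost_nonneg _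
  change _ ≤ I.setCost T * _ at h2
  have h4 : I.setCost T * (16 * Real.log (KK l.length + 1) + 12) ≤
      I.setCost T * (28 * (1 + Real.log (1 + Real.log (1 + (l.length : ℝ))))) := by
    gcongr
    linarith
  linarith

lemma exists_M (S : Finset (ℕ × ℕ)) (m : ℕ) : ∃ M : ℕ, 0 < M ∧
    ∀ l : List (Fin n), l.length ≤ m → ∀ i s, (i, s) ∈ S → (QQ Λ M l i s : ℚ) = M * qq Λ l i s := by
  have hfin : {l : List (Fin n) | l.length ≤ m}.Finite := List.finite_length_le _ _
  refine ⟨∏ l ∈ hfin.toFinset, ∏ v ∈ S, (qq Λ l v.1 v.2).den, ?_, ?_⟩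
  · exact Finset.prod_pos fun l _ => Finset.prod_pos fun v _ => Rat.den_pos _
  · intro l hl i s hS
    set M := ∏ l ∈ hfin.toFinset, ∏ v ∈ S, (qq Λ l v.1 v.2).den with hM
    have hd : (qq Λ l i s).den ∣ M :=
      (Finset.dvd_prod_of_mem (fun v : ℕ × ℕ => (qq Λ l v.1 v.2).den) hS).trans
        (Finset.dvd_prod_of_mem (fun l => ∏ v ∈ S, (qq Λ l v.1 v.2).den) (by simpa using hl))
    obtain ⟨c, hc⟩ := hd
    have h0 := qq_nonneg Λ l i s
    obtain ⟨a, ha⟩ := Int.eq_ofNat_of_zero_le (Rat.num_nonneg.2 h0)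
    have h1 : (M : ℚ) * qq Λ l i s = ((a * c : ℕ) : ℚ) := by
      rw [hc]
      have h2 : qq Λ l i s * (qq Λ l i s).den = a := by
        rw [Rat.mul_den_eq_num, ha]; simp
      push_cast
      rw [← h2]; ring
    unfold QQ
    rw [h1, Nat.floor_natCast]

lemma tsum_map {Ω β : Type*} [Fintype Ω] [Nonempty Ω] (g : Ω → β) (f : β → ℝ) :
    ∑' b, (((PMF.uniformOfFintype Ω).map g) b).toReal * f b = (∑ θ, f (g θ)) / Fintype.card Ω := by
  classical
  have h1 : ∀ b, (((PMF.uniformOfFintype Ω).map g) b).toReal * f b =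
      ∑ θ, (if b = g θ then (Fintype.card Ω : ℝ)⁻¹ * f (g θ) else 0) := by
    intro b
    rw [PMF.map_apply, tsum_fintype, ENNReal.toReal_sum]
    · rw [Finset.sum_mul]
      refine Finset.sum_congr rfl fun θ _ => ?_
      split_ifs with h
      · rw [h]; simp [PMF.uniformOfFintype_apply]
      · simp
    · intro θ _
      split_ifs
      · simp [PMF.uniformOfFintype_apply]
      · simp
  rw [tsum_congr h1]
  have h2 : HasSum (fun b => ∑ θ, (if b = g θ then (Fintype.card Ω : ℝ)⁻¹ * f (g θ) else 0))
      (∑ θ, (Fintype.card Ω : ℝ)⁻¹ * f (g θ)) := by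
    refine hasSum_sum fun θ _ => ?_
    have := hasSum_ite_eq (g θ) ((Fintype.card Ω : ℝ)⁻¹ * f (g θ))
    exact this
  rw [h2.tsum_eq, ← Finset.mul_sum]
  ring

lemma main (I : WPAPInstance n L) : ∃ μ : PMF (List (Fin n) → Finset L),
    (∀ A ∈ μ.support, I.IsOnlineAlg A) ∧
    ∀ σ : List (Fin n), σ.Nodup →
      (∑' A : List (Fin n) → Finset L, (μ A).toReal * I.setCost (A σ)) ≤
        168 * (1 + Real.log (1 + Real.log (1 + (σ.length : ℝ)))) * I.optCost σ.toFinset := by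
  obtain ⟨Λ⟩ := exists_lam I
  let S : Finset (ℕ × ℕ) := Finset.range (Finset.univ.sup Λ.lev + KK n) ×ˢ Finset.range n
  obtain ⟨M, hM, hQ⟩ := exists_M Λ S n
  haveI : Nonempty (S → Fin M) := ⟨fun _ => ⟨0, hM⟩⟩
  refine ⟨(PMF.uniformOfFintype (S → Fin M)).map fun θ σ => alg Λ M S θ σ.reverse, ?_, ?_⟩
  · intro A hA
    rw [PMF.support_map] at hA
    obtain ⟨θ, -, rfl⟩ := hA
    refine ⟨fun σ x => ?_, fun σ e he => ?_⟩
    · simp only [List.reverse_append, List.reverse_cons, List.reverse_nil, List.nil_append, List.singleton_append]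
      exact Finset.subset_union_left
    · exact alg_cov Λ M S hM θ σ.reverse e (by simpa using he)
  · intro σ hσ
    rw [tsum_map]
    have hlen : σ.reverse.length ≤ n := by
      simpa using hσ.length_le_card
    have hS : ∀ (e : Fin n) (k : ℕ), k < KK n → (Λ.lev e + k, Λ.sg (Λ.lev e + k) e) ∈ S := by
      intro e k hk
      have := Finset.le_sup (f := Λ.lev) (Finset.mem_univ e)
      simp only [S, Finset.mem_product, Finset.mem_range]
      exact ⟨by omega, Λ.sg_lt _ _⟩
    have h1 := alg_cost Λ M S n hS hQ σ.reverse hlen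
    have hpos : (0 : ℝ) < Fintype.card (S → Fin M) := by exact_mod_cast Fintype.card_pos
    have h2 : (∑ θ : S → Fin M, I.setCost (alg Λ M S θ σ.reverse)) / Fintype.card (S → Fin M) ≤
        6 * bsum Λ σ.reverse := by
      rw [div_le_iff₀ hpos]; linarith
    refine h2.trans ?_
    have hx : 0 ≤ Real.log (1 + (σ.length : ℝ)) := Real.log_nonneg (by linarith [(Nat.cast_nonneg σ.length : (0:ℝ) ≤ _)])
    have hy : 0 ≤ Real.log (1 + Real.log (1 + (σ.length : ℝ))) := Real.log_nonneg (by linarith)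
    rw [← div_le_iff₀' (by positivity)]
    unfold WPAPInstance.optCost
    apply le_csInf
    · exact ⟨_, Finset.univ, fun e _ => by
        obtain ⟨ℓ, hl⟩ := I.covered e
        exact ⟨ℓ, Finset.mem_univ _, hl⟩, rfl⟩
    · rintro r ⟨T, hT, rfl⟩
      rw [div_le_iff₀' (by positivity)]
      have := bsum_opt Λ σ.reverse T (fun e he => hT e (by simpa using he))
      rwa [List.length_reverse] at this

end WP

theorem stmt9 :
    ∃ C : ℝ, 0 < C ∧
      ∀ (n : ℕ) (L : Type) [Fintype L] [DecidableEq L], 1 ≤ n →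
        ∀ I : WPAPInstance n L,
          ∃ μ : PMF (List (Fin n) → Finset L),
            (∀ A ∈ μ.support, I.IsOnlineAlg A) ∧
            ∀ σ : List (Fin n), σ.Nodup →
              (∑' A : List (Fin n) → Finset L, (μ A).toReal * I.setCost (A σ)) ≤
                C * (1 + Real.log (1 + Real.log (1 + (σ.length : ℝ)))) *
                  I.optCost σ.toFinset := by
  refine ⟨168, by norm_num, ?_⟩
  intro n L _ _ _ I
  exact WP.main I
end

section
/- There is a constant C > 0 such that for every weighted path augmentation (WPAP) instance and every prediction X̂ : Finset (Fin n), there exists a deterministic online algorithm ALG satisfying, for every duplicate-free request sequence σ, c(ALG σ) ≤ C · (1 + log(1 + η(σ))) · opt(σ.toFinset), where log is the natural logarithm. -/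
open Finset

variable {n : ℕ} {L : Type} [Fintype L] [DecidableEq L]

namespace WPAPaux

/-- Load of a link. -/
noncomputable def load {n : ℕ} {L : Type} [Fintype L] [DecidableEq L] (I : WPAPInstance n L)
    (y : Fin n → ℝ) (ℓ : L) : ℝ := ∑ e ∈ Finset.Icc (I.lo ℓ) (I.hi ℓ), y e

theorem online_exists {α β : Type} (Inv : List α → β → Prop) (rel : β → β → Prop)
    (h0 : ∃ b, Inv [] b)
    (hs : ∀ σ b x, Inv σ b → ∃ b', Inv (σ ++ [x]) b' ∧ rel b b') :
    ∃ f : List α → β, ∀ σ, Inv σ (f σ) ∧ ∀ x, rel (f σ) (f (σ ++ [x])) := by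
  classical
  let stepc : ∀ (l : List α) (x : α), {b // Inv l.reverse b} → {b // Inv (x :: l).reverse b} :=
    fun l x b => ⟨(hs l.reverse b.1 x b.2).choose, by
      have := (hs l.reverse b.1 x b.2).choose_spec.1
      simpa using this⟩
  let g : ∀ l : List α, {b // Inv l.reverse b} := fun l =>
    List.rec (motive := fun l => {b // Inv l.reverse b}) ⟨h0.choose, by simpa using h0.choose_spec⟩
      (fun x l b => stepc l x b) l
  refine ⟨fun σ => (g σ.reverse).1, fun σ => ⟨?_, fun x => ?_⟩⟩
  · have := (g σ.reverse).2
    simpa using this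
  · have h : (σ ++ [x]).reverse = x :: σ.reverse := by simp
    have h2 : rel (g σ.reverse).1 (g (x :: σ.reverse)).1 :=
      (hs σ.reverse.reverse (g σ.reverse).1 x (g σ.reverse).2).choose_spec.2
    have hg : ∀ l l', l = l' → rel (g σ.reverse).1 (g l).1 → rel (g σ.reverse).1 (g l').1 := by
      rintro l l' rfl h3
      exact h3
    exact hg _ _ h.symm h2

section

theorem setCost_union (I : WPAPInstance n L) (A B : Finset L) :
    I.setCost (A ∪ B) ≤ I.setCost A + I.setCost B := by
  unfold WPAPInstance.setCost
  have h := Finset.sum_union_inter (s₁ := A) (s₂ := B) (f := I.cost)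
  have h2 : 0 ≤ ∑ ℓ ∈ A ∩ B, I.cost ℓ := Finset.sum_nonneg (fun i _ => I.cost_nonneg i)
  linarith

theorem setCost_mono (I : WPAPInstance n L) {A B : Finset L} (h : A ⊆ B) :
    I.setCost A ≤ I.setCost B :=
  Finset.sum_le_sum_of_subset_of_nonneg h (fun i _ _ => I.cost_nonneg i)

theorem setCost_nonneg (I : WPAPInstance n L) (A : Finset L) : 0 ≤ I.setCost A :=
  Finset.sum_nonneg (fun i _ => I.cost_nonneg i)

theorem pair_exists (I : WPAPInstance n L) (e : Fin n) (κ : ℝ) (ℓ0 : L)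
    (h0 : e ∈ Finset.Icc (I.lo ℓ0) (I.hi ℓ0)) (hc0 : I.cost ℓ0 ≤ κ) :
    ∃ Q : Finset L, I.setCost Q ≤ 2 * κ ∧ ∀ ℓ, e ∈ Finset.Icc (I.lo ℓ) (I.hi ℓ) → I.cost ℓ ≤ κ →
      ∀ x ∈ Finset.Icc (I.lo ℓ) (I.hi ℓ), ∃ ℓ' ∈ Q, I.lo ℓ' ≤ x ∧ x ≤ I.hi ℓ' := by
  classical
  let F : Finset L := univ.filter (fun ℓ => e ∈ Finset.Icc (I.lo ℓ) (I.hi ℓ) ∧ I.cost ℓ ≤ κ)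
  have hF : F.Nonempty := ⟨ℓ0, by simp only [F, mem_filter, mem_univ, true_and]; exact ⟨h0, hc0⟩⟩
  obtain ⟨a, ha, hamin⟩ := F.exists_min_image I.lo hF
  obtain ⟨b, hb, hbmax⟩ := F.exists_max_image I.hi hF
  simp only [F, mem_filter, mem_univ, true_and, mem_Icc] at ha hb hamin hbmax
  refine ⟨{a} ∪ {b}, ?_, ?_⟩
  · have := setCost_union I {a} {b}
    simp only [WPAPInstance.setCost, sum_singleton] at this ⊢
    linarith [ha.2, hb.2]
  · intro ℓ hℓ hc x hx
    rw [mem_Icc] at hℓ hx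
    have h1 := hamin ℓ ⟨hℓ, hc⟩
    have h2 := hbmax ℓ ⟨hℓ, hc⟩
    rcases le_total x e with h | h
    · exact ⟨a, by simp, h1.trans hx.1, h.trans ha.1.2⟩
    · exact ⟨b, by simp, hb.1.1.trans h, hx.2.trans h2⟩

/-- State of the primal-dual algorithm. -/
structure St (n : ℕ) (L : Type) where
  y : Fin n → ℝ
  R : Finset (Fin n)
  lk : Fin n → L
  S : Finset L

/-- Invariant of the primal-dual algorithm. -/
structure Inv (I : WPAPInstance n L) (σ : List (Fin n)) (s : St n L) : Prop where
  nonneg : ∀ e, 0 ≤ s.y e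
  supp : ∀ e, e ∉ σ → s.y e = 0
  feas : ∀ ℓ, load I s.y ℓ ≤ I.cost ℓ
  tight : ∀ e ∈ s.R, I.cost (s.lk e) ≤ load I s.y (s.lk e)
  memR : ∀ e ∈ s.R, e ∈ Finset.Icc (I.lo (s.lk e)) (I.hi (s.lk e))
  sep : ∀ e ∈ s.R, ∀ e' ∈ s.R, e ≠ e' → I.cost (s.lk e') ≤ 2 * I.cost (s.lk e) →
    I.cost (s.lk e) ≤ 2 * I.cost (s.lk e') → e' ∉ Finset.Icc (I.lo (s.lk e)) (I.hi (s.lk e))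
  covR : ∀ e ∈ s.R, ∀ ℓ, e ∈ Finset.Icc (I.lo ℓ) (I.hi ℓ) → I.cost ℓ ≤ 2 * I.cost (s.lk e) →
    ∀ x ∈ Finset.Icc (I.lo ℓ) (I.hi ℓ), ∃ ℓ' ∈ s.S, I.lo ℓ' ≤ x ∧ x ≤ I.hi ℓ'
  sub : s.R ⊆ σ.toFinset
  cov : I.Covers s.S σ.toFinset
  costS : I.setCost s.S ≤ ∑ e ∈ s.R, 4 * I.cost (s.lk e)

theorem load_update (I : WPAPInstance n L) (y : Fin n → ℝ) (x : Fin n) (d : ℝ) (ℓ : L) :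
    load I (fun e => y e + if e = x then d else 0) ℓ =
      load I y ℓ + if x ∈ Finset.Icc (I.lo ℓ) (I.hi ℓ) then d else 0 := by
  unfold load
  rw [Finset.sum_add_distrib, Finset.sum_ite_eq']

theorem step (I : WPAPInstance n L) (σ : List (Fin n)) (s : St n L) (x : Fin n)
    (h : Inv I σ s) : ∃ s', Inv I (σ ++ [x]) s' ∧ s.S ⊆ s'.S := by
  classical
  have hmem : ∀ e, e ∉ σ ++ [x] → e ∉ σ := fun e he h => he (by simp [h])
  have hsub : σ.toFinset ⊆ (σ ++ [x]).toFinset := by intro e; simp; tauto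
  by_cases hx : ∃ ℓ ∈ s.S, I.lo ℓ ≤ x ∧ x ≤ I.hi ℓ
  · refine ⟨s, ⟨h.nonneg, fun e he => h.supp e (hmem e he), h.feas, h.tight, h.memR, h.sep,
      h.covR, h.sub.trans hsub, ?_, h.costS⟩, Subset.rfl⟩
    intro e he
    simp only [List.toFinset_append, mem_union, List.mem_toFinset, List.mem_singleton] at he
    rcases he with he | he
    · exact h.cov e (by simpa using he)
    · subst he; exact hx
  · have hxR : x ∉ s.R := fun hR => hx (h.cov x (h.sub hR))
    let F : Finset L := univ.filter (fun ℓ => x ∈ Finset.Icc (I.lo ℓ) (I.hi ℓ))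
    have hF : F.Nonempty := by
      obtain ⟨ℓ, hℓ⟩ := I.covered x
      exact ⟨ℓ, by simpa [F] using hℓ⟩
    obtain ⟨a, ha, hamin⟩ := F.exists_min_image (fun ℓ => I.cost ℓ - load I s.y ℓ) hF
    have hxa : x ∈ Finset.Icc (I.lo a) (I.hi a) := (mem_filter.1 ha).2
    set d := I.cost a - load I s.y a with hd
    have hd0 : 0 ≤ d := by have := h.feas a; linarith
    obtain ⟨Q, hQc, hQ⟩ := pair_exists I x (2 * I.cost a) a hxa
      (by linarith [I.cost_nonneg a])
    have hlk : ∀ e ∈ s.R, Function.update s.lk x a e = s.lk e := fun e he =>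
      Function.update_of_ne (fun h' => hxR (by rw [← h']; exact he)) _ _
    have hlkx : Function.update s.lk x a x = a := Function.update_self _ _ _
    have hA : ∀ e ∈ s.R, x ∉ Finset.Icc (I.lo (s.lk e)) (I.hi (s.lk e)) := fun e he hc =>
      hx (h.covR e he _ (h.memR e he) (by linarith [I.cost_nonneg (s.lk e)]) x hc)
    have hload : ∀ ℓ, load I s.y ℓ ≤ load I (fun e => s.y e + if e = x then d else 0) ℓ := by
      intro ℓ; rw [load_update]; split_ifs <;> linarith
    refine ⟨⟨fun e => s.y e + if e = x then d else 0, insert x s.R, Function.update s.lk x a,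
      s.S ∪ Q⟩, ⟨?_, ?_, ?_, ?_, ?_, ?_, ?_, ?_, ?_, ?_⟩, subset_union_left⟩
    · intro e
      have := h.nonneg e
      dsimp only
      split_ifs <;> linarith
    · intro e he
      have h1 := h.supp e (hmem e he)
      have h2 : e ≠ x := fun h => he (by simp [h])
      simp [h1, h2]
    · intro ℓ
      rw [load_update]
      split_ifs with hc
      · have := hamin ℓ (by simpa [F] using hc)
        linarith
      · linarith [h.feas ℓ]
    · intro e he
      dsimp only
      rcases mem_insert.1 he with rfl | he
      · rw [hlkx, load_update, if_pos hxa]; linarith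
      · rw [hlk e he]; exact (h.tight e he).trans (hload _)
    · intro e he
      dsimp only
      rcases mem_insert.1 he with rfl | he
      · rw [hlkx]; exact hxa
      · rw [hlk e he]; exact h.memR e he
    · intro e he e' he' hne
      dsimp only
      rcases mem_insert.1 he with rfl | he1 <;> rcases mem_insert.1 he' with rfl | he2
      · exact absurd rfl hne
      · rw [hlkx, hlk e' he2]
        intro h1 h2 h3
        exact hx (h.covR e' he2 a h3 h2 _ hxa)
      · rw [hlkx, hlk e he1]
        intro h1 h2
        exact hA e he1
      · rw [hlk e he1, hlk e' he2]
        exact h.sep e he1 e' he2 hne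
    · intro e he ℓ
      dsimp only
      rcases mem_insert.1 he with rfl | he
      · rw [hlkx]
        intro h1 h2 z hz
        obtain ⟨ℓ', h3, h4⟩ := hQ ℓ h1 h2 z hz
        exact ⟨ℓ', mem_union_right _ h3, h4⟩
      · rw [hlk e he]
        intro h1 h2 z hz
        obtain ⟨ℓ', h3, h4⟩ := h.covR e he ℓ h1 h2 z hz
        exact ⟨ℓ', mem_union_left _ h3, h4⟩
    · intro e he
      rcases mem_insert.1 he with rfl | he
      · simp
      · exact hsub (h.sub he)
    · intro e he
      simp only [List.toFinset_append, mem_union, List.mem_toFinset, List.mem_singleton] at he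
      rcases he with he | he
      · obtain ⟨ℓ', h3, h4⟩ := h.cov e (by simpa using he)
        exact ⟨ℓ', mem_union_left _ h3, h4⟩
      · have he : e = x := by simpa using he
        subst he
        obtain ⟨ℓ', h3, h4⟩ := hQ a hxa (by linarith [I.cost_nonneg a]) e hxa
        exact ⟨ℓ', mem_union_right _ h3, h4⟩
    · dsimp only
      rw [sum_insert hxR, hlkx]
      have h1 : ∑ e ∈ s.R, 4 * I.cost (Function.update s.lk x a e) =
          ∑ e ∈ s.R, 4 * I.cost (s.lk e) := sum_congr rfl (fun e he => by rw [hlk e he])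
      rw [h1]
      have := setCost_union I s.S Q
      linarith [h.costS]

theorem overlap (I : WPAPInstance n L) (lk : Fin n → L) (F : Finset (Fin n))
    (hm : ∀ e ∈ F, e ∈ Finset.Icc (I.lo (lk e)) (I.hi (lk e)))
    (hs : ∀ e ∈ F, ∀ e' ∈ F, e ≠ e' → e' ∉ Finset.Icc (I.lo (lk e)) (I.hi (lk e))) (x : Fin n) :
    (F.filter (fun e => x ∈ Finset.Icc (I.lo (lk e)) (I.hi (lk e)))).card ≤ 2 := by
  by_contra hc
  obtain ⟨a, ha, b, hb, c, hc, hab, hac, hbc⟩ := Finset.two_lt_card.1 (not_le.1 hc)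
  simp only [mem_filter] at ha hb hc
  have h1 := hs a ha.1 b hb.1 hab
  have h2 := hs a ha.1 c hc.1 hac
  have h3 := hs b hb.1 a ha.1 hab.symm
  have h4 := hs b hb.1 c hc.1 hbc
  have h5 := hs c hc.1 a ha.1 hac.symm
  have h6 := hs c hc.1 b hb.1 hbc.symm
  have k1 := hm a ha.1
  have k2 := hm b hb.1
  have k3 := hm c hc.1
  have l1 := ha.2
  have l2 := hb.2
  have l3 := hc.2
  simp only [mem_Icc, Fin.le_def] at *
  omega

theorem level (I : WPAPInstance n L) (y : Fin n → ℝ) (hy : ∀ e, 0 ≤ y e) (lk : Fin n → L)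
    (F : Finset (Fin n))
    (hm : ∀ e ∈ F, e ∈ Finset.Icc (I.lo (lk e)) (I.hi (lk e)))
    (ht : ∀ e ∈ F, I.cost (lk e) ≤ load I y (lk e))
    (hs : ∀ e ∈ F, ∀ e' ∈ F, e ≠ e' → e' ∉ Finset.Icc (I.lo (lk e)) (I.hi (lk e))) :
    ∑ e ∈ F, I.cost (lk e) ≤ 2 * ∑ e, y e := by
  calc ∑ e ∈ F, I.cost (lk e) ≤ ∑ e ∈ F, load I y (lk e) := sum_le_sum ht
    _ = ∑ e ∈ F, ∑ x, if x ∈ Finset.Icc (I.lo (lk e)) (I.hi (lk e)) then y x else 0 := by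
        refine sum_congr rfl (fun e _ => ?_)
        unfold load
        rw [← sum_filter]
        congr 1
        ext; simp
    _ = ∑ x, ∑ e ∈ F, if x ∈ Finset.Icc (I.lo (lk e)) (I.hi (lk e)) then y x else 0 := sum_comm
    _ ≤ ∑ x, 2 * y x := by
        refine sum_le_sum (fun x _ => ?_)
        rw [← sum_filter, sum_const, nsmul_eq_mul]
        refine mul_le_mul_of_nonneg_right ?_ (hy x)
        exact_mod_cast overlap I lk F hm hs x
    _ = _ := by rw [mul_sum]

theorem total (I : WPAPInstance n L) (y : Fin n → ℝ) (hy : ∀ e, 0 ≤ y e) (lk : Fin n → L)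
    (R : Finset (Fin n))
    (hm : ∀ e ∈ R, e ∈ Finset.Icc (I.lo (lk e)) (I.hi (lk e)))
    (ht : ∀ e ∈ R, I.cost (lk e) ≤ load I y (lk e))
    (hs : ∀ e ∈ R, ∀ e' ∈ R, e ≠ e' → I.cost (lk e') ≤ 2 * I.cost (lk e) →
    I.cost (lk e) ≤ 2 * I.cost (lk e') → e' ∉ Finset.Icc (I.lo (lk e)) (I.hi (lk e))) :
    ∑ e ∈ R, I.cost (lk e) ≤ (∑ e, y e) * (3 + 2 * (Nat.log 2 R.card : ℝ)) := by
  classical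
  set D := ∑ e, y e with hD
  have hD0 : 0 ≤ D := sum_nonneg (fun e _ => hy e)
  have hle : ∀ e ∈ R, I.cost (lk e) ≤ D := fun e he => (ht e he).trans
    (sum_le_sum_of_subset_of_nonneg (subset_univ _) (fun i _ _ => hy i))
  rcases hD0.eq_or_lt with h0 | hDpos
  · rw [← h0, zero_mul]
    exact sum_nonpos (fun e he => h0 ▸ hle e he)
  rcases R.eq_empty_or_nonempty with rfl | hne
  · simp; positivity
  have hk : 0 < (R.card : ℝ) := by exact_mod_cast hne.card_pos
  set k := R.card with hkdef
  rw [← sum_filter_add_sum_filter_not R (fun e => (k : ℝ) * I.cost (lk e) / D < 1)]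
  have h1 : ∑ e ∈ R with (k : ℝ) * I.cost (lk e) / D < 1, I.cost (lk e) ≤ D := by
    calc _ ≤ ∑ e ∈ R with (k : ℝ) * I.cost (lk e) / D < 1, D / k := by
          refine sum_le_sum (fun e he => ?_)
          have := (mem_filter.1 he).2
          rw [div_lt_one hDpos] at this
          rw [le_div_iff₀ hk]; linarith
      _ ≤ ∑ e ∈ R, D / k := sum_le_sum_of_subset_of_nonneg (filter_subset _ _)
          (fun _ _ _ => by positivity)
      _ = D := by rw [sum_const, nsmul_eq_mul, ← hkdef]; field_simp
  set G := R.filter (fun e => ¬ (k : ℝ) * I.cost (lk e) / D < 1) with hG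
  let lv : Fin n → ℕ := fun e => Nat.log 2 ⌊(k : ℝ) * I.cost (lk e) / D⌋₊
  have h2 : ∑ e ∈ G, I.cost (lk e) ≤ ∑ i ∈ range (Nat.log 2 k + 1), 2 * D := by
    rw [← sum_fiberwise_of_maps_to (t := range (Nat.log 2 k + 1)) (g := lv)]
    · refine sum_le_sum (fun i _ => ?_)
      have hsub : ∀ e ∈ G.filter (fun e => lv e = i), e ∈ R := fun e he =>
        (mem_filter.1 (mem_filter.1 he).1).1
      have hlv : ∀ e ∈ G.filter (fun e => lv e = i), (2:ℝ)^i ≤ (k : ℝ) * I.cost (lk e) / D ∧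
          (k : ℝ) * I.cost (lk e) / D < 2^(i+1) := by
        intro e he
        obtain ⟨he1, he2⟩ := mem_filter.1 he
        have he3 := not_lt.1 (mem_filter.1 he1).2
        have hfl : ⌊(k : ℝ) * I.cost (lk e) / D⌋₊ ≠ 0 := by
          have := (Nat.one_le_floor_iff _).2 he3
          omega
        have hp1 := Nat.pow_log_le_self 2 hfl
        have hp2 := Nat.lt_pow_succ_log_self (b := 2) (by norm_num)
          ⌊(k : ℝ) * I.cost (lk e) / D⌋₊
        change Nat.log 2 _ = i at he2
        rw [he2] at hp1 hp2
        constructor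
        · have := (Nat.le_floor_iff (by linarith)).1 hp1
          exact_mod_cast this
        · have := (Nat.floor_lt (by linarith)).1 hp2
          exact_mod_cast this
      have h2x : ∀ e ∈ G.filter (fun e => lv e = i), ∀ e' ∈ G.filter (fun e => lv e = i),
          I.cost (lk e) ≤ 2 * I.cost (lk e') := by
        intro e he e' he'
        have a1 := (hlv e he).2
        have a2 := (hlv e' he').1
        have a3 : (k : ℝ) * I.cost (lk e) / D < 2 * ((k : ℝ) * I.cost (lk e') / D) := by
          rw [pow_succ] at a1; linarith
        rw [← mul_div_assoc, div_lt_div_iff_of_pos_right hDpos] at a3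
        nlinarith
      exact level I y hy lk _ (fun e he => hm e (hsub e he)) (fun e he => ht e (hsub e he))
        (fun e he e' he' hne => hs e (hsub e he) e' (hsub e' he') hne (h2x e' he' e he)
          (h2x e he e' he'))
    · intro e he
      rw [mem_range, Nat.lt_succ_iff]
      apply Nat.log_mono_right
      apply Nat.floor_le_of_le
      rw [div_le_iff₀ hDpos]
      exact mul_le_mul_of_nonneg_left (hle e (mem_filter.1 he).1) hk.le
  rw [sum_const, card_range, nsmul_eq_mul] at h2
  push_cast at h2
  linarith

theorem weak_duality (I : WPAPInstance n L) (y : Fin n → ℝ) (hy : ∀ e, 0 ≤ y e)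
    (A : Finset (Fin n)) (hsupp : ∀ e, e ∉ A → y e = 0) (hf : ∀ ℓ, load I y ℓ ≤ I.cost ℓ)
    (T : Finset L) (hT : I.Covers T A) : ∑ e, y e ≤ I.setCost T := by
  classical
  calc ∑ e, y e ≤ ∑ e, ∑ ℓ ∈ T, if e ∈ Finset.Icc (I.lo ℓ) (I.hi ℓ) then y e else 0 := by
        refine sum_le_sum (fun e _ => ?_)
        have hnn : ∀ ℓ ∈ T, 0 ≤ if e ∈ Finset.Icc (I.lo ℓ) (I.hi ℓ) then y e else 0 := by
          intro ℓ _; split_ifs; exacts [hy e, le_rfl]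
        by_cases he : e ∈ A
        · obtain ⟨ℓ, h1, h2⟩ := hT e he
          refine le_trans (le_of_eq ?_) (single_le_sum hnn h1)
          rw [if_pos (mem_Icc.2 h2)]
        · rw [hsupp e he]; simp
    _ = ∑ ℓ ∈ T, ∑ e, if e ∈ Finset.Icc (I.lo ℓ) (I.hi ℓ) then y e else 0 := sum_comm
    _ ≤ ∑ ℓ ∈ T, I.cost ℓ := by
        refine sum_le_sum (fun ℓ _ => le_trans (le_of_eq ?_) (hf ℓ))
        unfold load
        rw [← sum_filter]
        congr 1
        ext; simp

theorem log_bound (k m : ℕ) (h : k ≤ m) :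
    4 * (3 + 2 * (Nat.log 2 k : ℝ)) ≤ 16 * (1 + Real.log (1 + m)) := by
  have h1 : (Nat.log 2 k : ℝ) ≤ 2 * Real.log (1 + m) := by
    rcases Nat.eq_zero_or_pos k with rfl | hk
    · simp; exact Real.log_nonneg (by linarith [(Nat.cast_nonneg m : (0:ℝ) ≤ m)])
    have h2 : (2:ℝ) ^ (Nat.log 2 k) ≤ 1 + m := by
      have := Nat.pow_log_le_self 2 hk.ne'
      have h3 : 2 ^ (Nat.log 2 k) ≤ 1 + m := by omega
      exact_mod_cast h3
    have h4 := Real.log_le_log (by positivity) h2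
    rw [Real.log_pow] at h4
    have := Real.log_two_gt_d9
    have h5 : (0:ℝ) ≤ (Nat.log 2 k : ℝ) := Nat.cast_nonneg _
    nlinarith
  linarith

theorem base_alg (I : WPAPInstance n L) :
    ∃ A : List (Fin n) → Finset L, I.IsOnlineAlg A ∧ ∀ σ T, I.Covers T σ.toFinset →
      I.setCost (A σ) ≤ 16 * (1 + Real.log (1 + (σ.toFinset.card : ℝ))) * I.setCost T := by
  classical
  have h0 : ∃ s : St n L, Inv I [] s := by
    refine ⟨⟨fun _ => 0, ∅, fun e => (I.covered e).choose, ∅⟩, ?_⟩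
    constructor <;> simp [load, I.cost_nonneg, WPAPInstance.Covers, WPAPInstance.setCost]
  obtain ⟨f, hf⟩ := online_exists (Inv I) (fun s s' => s.S ⊆ s'.S) h0 (step I)
  refine ⟨fun σ => (f σ).S, ⟨fun σ x => (hf σ).2 x, fun σ => (hf σ).1.cov⟩, fun σ T hT => ?_⟩
  have h := (hf σ).1
  have h1 := total I _ h.nonneg _ _ h.memR h.tight h.sep
  have h2 := weak_duality I _ h.nonneg σ.toFinset (fun e he => h.supp e (by simpa using he))
    h.feas T hT
  have h3 := log_bound _ _ (card_le_card h.sub)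
  have h4 := h.costS
  rw [← mul_sum] at h4
  have h5 : 0 ≤ ∑ e, (f σ).y e := sum_nonneg (fun e _ => h.nonneg e)
  have h6 : 0 ≤ Real.log (1 + (σ.toFinset.card : ℝ)) :=
    Real.log_nonneg (by linarith [(Nat.cast_nonneg (σ.toFinset.card) : (0:ℝ) ≤ _)])
  calc I.setCost (f σ).S ≤ (∑ e, (f σ).y e) * (4 * (3 + 2 * (Nat.log 2 (f σ).R.card : ℝ))) := by
        linarith
    _ ≤ (∑ e, (f σ).y e) * (16 * (1 + Real.log (1 + (σ.toFinset.card : ℝ)))) :=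
        mul_le_mul_of_nonneg_left h3 h5
    _ ≤ I.setCost T * (16 * (1 + Real.log (1 + (σ.toFinset.card : ℝ)))) :=
        mul_le_mul_of_nonneg_right h2 (by positivity)
    _ = _ := by ring

/-- Budgets. -/
noncomputable def bud (δ : ℝ) : ℕ → ℝ
  | 0 => 0
  | q + 1 => δ * 2 ^ q

theorem bud_nonneg {δ : ℝ} (hδ : 0 < δ) (p : ℕ) : 0 ≤ bud δ p := by
  cases p with
  | zero => exact le_rfl
  | succ q => unfold bud; positivity

theorem bud_sum {δ : ℝ} (hδ : 0 < δ) (p : ℕ) : ∑ q ∈ range p, bud δ q ≤ bud δ p := by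
  induction p with
  | zero => simp [bud]
  | succ q ih =>
    rw [sum_range_succ]
    have : 2 * bud δ q ≤ bud δ (q + 1) := by
      cases q with
      | zero => simp [bud]; exact hδ.le
      | succ r => simp only [bud, pow_succ]; linarith
    linarith

theorem exists_delta (I : WPAPInstance n L) : ∃ δ : ℝ, 0 < δ ∧ ∀ T : Finset L, 0 < I.setCost T →
    δ ≤ I.setCost T := by
  classical
  let F : Finset (Finset L) := univ.filter (fun T => 0 < I.setCost T)
  rcases F.eq_empty_or_nonempty with h | h
  · refine ⟨1, one_pos, fun T hT => ?_⟩
    have : T ∈ F := by simp [F, hT]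
    simp [h] at this
  · obtain ⟨a, ha, hmin⟩ := F.exists_min_image I.setCost h
    exact ⟨I.setCost a, (mem_filter.1 ha).2, fun T hT => hmin T (by simp [F, hT])⟩

set_option maxHeartbeats 1000000 in
theorem main (I : WPAPInstance n L) (Xhat : Finset (Fin n)) :
    ∃ ALG : List (Fin n) → Finset L, I.IsOnlineAlg ALG ∧ ∀ σ T, I.Covers T σ.toFinset →
      I.setCost (ALG σ) ≤ 128 * (1 + Real.log (1 + (predErr Xhat σ : ℝ))) * I.setCost T := by
  classical
  obtain ⟨A, ⟨hAm, hAc⟩, hA⟩ := base_alg I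
  obtain ⟨δ, hδ, hδmin⟩ := exists_delta I
  -- uncovered predicted elements
  let cv : Finset L → Fin n → Prop := fun T e => ∃ ℓ ∈ T, I.lo ℓ ≤ e ∧ e ≤ I.hi ℓ
  let un : Finset L → ℕ := fun T => (Xhat.filter (fun e => ¬ cv T e)).card
  have hP : ∀ p : ℕ, ∃ P : Finset L, I.setCost P ≤ bud δ p ∧
      ∀ T, I.setCost T ≤ bud δ p → un P ≤ un T := by
    intro p
    let F : Finset (Finset L) := univ.filter (fun T => I.setCost T ≤ bud δ p)
    have hF : F.Nonempty := ⟨∅, mem_filter.2 ⟨mem_univ _, by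
      simpa [WPAPInstance.setCost] using bud_nonneg hδ p⟩⟩
    obtain ⟨a, ha, hmin⟩ := F.exists_min_image un hF
    exact ⟨a, (mem_filter.1 ha).2, fun T hT => hmin T (by simp [F, hT])⟩
  choose P hPc hPmin using hP
  let Ap : ℕ → List (Fin n) → Finset L := fun p σ => A (σ.filter (fun e => ¬ cv (P p) e))
  have hApm : ∀ p σ x, Ap p σ ⊆ Ap p (σ ++ [x]) := by
    intro p σ x
    simp only [Ap, List.filter_append]
    by_cases hx : cv (P p) x
    · simp [hx]
    · simpa [hx] using hAm _ x
  have hex : ∀ σ, ∃ p, I.setCost (Ap p σ) ≤ bud δ p := by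
    intro σ
    obtain ⟨q, hq⟩ := pow_unbounded_of_one_lt (I.setCost univ / δ) (one_lt_two)
    refine ⟨q + 1, (setCost_mono I (subset_univ _)).trans ?_⟩
    rw [div_lt_iff₀ hδ] at hq
    simp only [bud]; linarith
  let p : List (Fin n) → ℕ := fun σ => Nat.find (hex σ)
  have hp : ∀ σ, I.setCost (Ap (p σ) σ) ≤ bud δ (p σ) := fun σ => Nat.find_spec (hex σ)
  have hpmin : ∀ σ q, q < p σ → bud δ q < I.setCost (Ap q σ) := fun σ q hq =>
    not_le.1 (Nat.find_min (hex σ) hq)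
  have hpm : ∀ σ x, p σ ≤ p (σ ++ [x]) := by
    intro σ x
    by_contra hc
    have h1 := hpmin σ _ (not_le.1 hc)
    have h2 := hp (σ ++ [x])
    have h3 := setCost_mono I (hApm (p (σ ++ [x])) σ x)
    linarith
  let B : ℕ → List (Fin n) → Finset L := fun q σ => P q ∪ Ap q σ
  have hBm : ∀ q σ x, B q σ ⊆ B q (σ ++ [x]) := fun q σ x => union_subset_union_right (hApm q σ x)
  have hBc : ∀ σ, I.setCost (B (p σ) σ) ≤ 2 * bud δ (p σ) := by
    intro σ
    have := setCost_union I (P (p σ)) (Ap (p σ) σ)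
    have h2 := hPc (p σ)
    have h3 := hp σ
    simp only [B]; linarith
  let J : List (Fin n) → Finset L → Prop := fun σ S => B (p σ) σ ⊆ S ∧
    ∃ S0, S ⊆ S0 ∪ B (p σ) σ ∧ I.setCost S0 ≤ 2 * ∑ q ∈ range (p σ), bud δ q
  have hJc : ∀ σ S, J σ S → I.setCost S ≤ 2 * ∑ q ∈ range (p σ + 1), bud δ q := by
    rintro σ S ⟨-, S0, h1, h2⟩
    have h3 := (setCost_mono I h1).trans (setCost_union I _ _)
    rw [sum_range_succ]
    linarith [hBc σ]
  have h0 : ∃ S, J [] S := by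
    refine ⟨B (p []) [], Subset.rfl, ∅, subset_union_right, ?_⟩
    have : 0 ≤ ∑ q ∈ range (p []), bud δ q := sum_nonneg (fun q _ => bud_nonneg hδ q)
    simp only [WPAPInstance.setCost, sum_empty]; linarith
  have hs : ∀ σ S x, J σ S → ∃ S', J (σ ++ [x]) S' ∧ S ⊆ S' := by
    intro σ S x hJ
    refine ⟨S ∪ B (p (σ ++ [x])) (σ ++ [x]), ⟨subset_union_right, ?_⟩, subset_union_left⟩
    rcases (hpm σ x).eq_or_lt with h | h
    · obtain ⟨-, S0, h1, h2⟩ := hJ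
      rw [← h]
      refine ⟨S0, union_subset (h1.trans (union_subset_union_right (hBm _ σ x)))
        subset_union_right, h2⟩
    · refine ⟨S, Subset.rfl, (hJc σ S hJ).trans ?_⟩
      have := sum_le_sum_of_subset_of_nonneg (f := bud δ)
        (range_subset_range.2 (Nat.succ_le_of_lt h)) (fun q _ _ => bud_nonneg hδ q)
      simp only [Nat.succ_eq_add_one] at this
      linarith
  obtain ⟨f, hf⟩ := online_exists J (fun S S' => S ⊆ S') h0 hs
  refine ⟨f, ⟨fun σ x => (hf σ).2 x, ?_⟩, ?_⟩
  · intro σ e he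
    have hB := (hf σ).1.1
    by_cases hc : cv (P (p σ)) e
    · obtain ⟨ℓ, h1, h2⟩ := hc
      exact ⟨ℓ, hB (mem_union_left _ h1), h2⟩
    · obtain ⟨ℓ, h1, h2⟩ := hAc (σ.filter (fun e => ¬ cv (P (p σ)) e)) e (by
        simp only [List.mem_toFinset, List.mem_filter, decide_eq_true_eq]
        exact ⟨by simpa using he, hc⟩)
      exact ⟨ℓ, hB (mem_union_right _ h1), h2⟩
  · intro σ T hT
    have hT0 := setCost_nonneg I T
    have hlog : 0 ≤ Real.log (1 + (predErr Xhat σ : ℝ)) :=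
      Real.log_nonneg (by linarith [(Nat.cast_nonneg (predErr Xhat σ) : (0:ℝ) ≤ _)])
    set Λ := 1 + Real.log (1 + (predErr Xhat σ : ℝ)) with hΛ
    have hcost : I.setCost (f σ) ≤ 4 * bud δ (p σ) := by
      have h1 := hJc σ _ (hf σ).1
      rw [sum_range_succ] at h1
      linarith [bud_sum hδ (p σ)]
    have key : ∀ q, q < p σ → bud δ q < 16 * Λ * I.setCost T ∧
        (bud δ q < I.setCost T ∨ bud δ q < I.setCost (Ap q σ) ∧
          I.setCost (Ap q σ) ≤ 16 * Λ * I.setCost T) := by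
      intro q hq
      by_cases hc : bud δ q < I.setCost T
      · exact ⟨by nlinarith [bud_nonneg hδ q], Or.inl hc⟩
      · have h1 := hPmin q T (not_lt.1 hc)
        have h2 := hpmin σ q hq
        have h3 := hA (σ.filter (fun e => ¬ cv (P q) e)) T (fun e he => hT e (by
          simp only [List.mem_toFinset, List.mem_filter] at he ⊢
          exact he.1))
        have h4 : (σ.filter (fun e => ¬ cv (P q) e)).toFinset.card ≤ predErr Xhat σ := by
          unfold predErr
          refine le_min (card_le_card ?_) ?_
          · intro e he
            simp only [List.mem_toFinset, List.mem_filter] at he ⊢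
            exact he.1
          · have h5 : un T ≤ (Xhat \ σ.toFinset).card := by
              refine card_le_card ?_
              intro e he
              obtain ⟨he1, he2⟩ := mem_filter.1 he
              exact mem_sdiff.2 ⟨he1, fun h => he2 (hT e h)⟩
            calc _ ≤ ((σ.toFinset \ Xhat) ∪ (Xhat.filter (fun e => ¬ cv (P q) e))).card := by
                  refine card_le_card ?_
                  intro e he
                  simp only [List.mem_toFinset, List.mem_filter, decide_eq_true_eq] at he
                  by_cases hX : e ∈ Xhat
                  · exact mem_union_right _ (mem_filter.2 ⟨hX, he.2⟩)
                  · exact mem_union_left _ (mem_sdiff.2 ⟨by simpa using he.1, hX⟩)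
              _ ≤ _ := (card_union_le _ _).trans (Nat.add_le_add_left (h1.trans h5) _)
        have h6 : Real.log (1 + ((σ.filter (fun e => ¬ cv (P q) e)).toFinset.card : ℝ)) ≤
            Real.log (1 + (predErr Xhat σ : ℝ)) := by
          apply Real.log_le_log (by positivity)
          have : ((σ.filter (fun e => ¬ cv (P q) e)).toFinset.card : ℝ) ≤ predErr Xhat σ := by
            exact_mod_cast h4
          linarith
        have h7 : I.setCost (Ap q σ) ≤ 16 * Λ * I.setCost T := by
          refine h3.trans (mul_le_mul_of_nonneg_right ?_ hT0)
          linarith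
        exact ⟨by linarith, Or.inr ⟨h2, h7⟩⟩
    rcases hpe : p σ with _ | r
    · rw [hpe] at hcost
      simp only [bud] at hcost
      have : 0 ≤ 128 * Λ * I.setCost T := by positivity
      linarith
    · have hk := (key r (by omega)).1
      rw [hpe] at hcost
      rcases r with _ | r
      · simp only [bud] at hk hcost
        have hTp : 0 < I.setCost T := by
          by_contra hc
          have : I.setCost T = 0 := le_antisymm (not_lt.1 hc) hT0
          rw [this] at hk; simp at hk
        have := hδmin T hTp
        nlinarith
      · simp only [bud, pow_succ] at hk hcost
        have : 0 ≤ Λ * I.setCost T := by positivity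
        nlinarith
end

end WPAPaux

theorem stmt10 :
    ∃ C : ℝ, 0 < C ∧
      ∀ (n : ℕ) (L : Type) [Fintype L] [DecidableEq L], 1 ≤ n →
        ∀ (I : WPAPInstance n L) (Xhat : Finset (Fin n)),
          ∃ ALG : List (Fin n) → Finset L, I.IsOnlineAlg ALG ∧
            ∀ σ : List (Fin n), σ.Nodup →
              I.setCost (ALG σ) ≤
                C * (1 + Real.log (1 + (predErr Xhat σ : ℝ))) * I.optCost σ.toFinset := by
  refine ⟨128, by norm_num, ?_⟩
  intro n L _ _ _ I Xhat
  obtain ⟨ALG, h1, h2⟩ := WPAPaux.main I Xhat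
  refine ⟨ALG, h1, fun σ _ => ?_⟩
  have hfin : {r : ℝ | ∃ T : Finset L, I.Covers T σ.toFinset ∧ r = I.setCost T}.Finite := by
    refine (Set.finite_range (fun T : Finset L => I.setCost T)).subset ?_
    rintro r ⟨T, -, rfl⟩
    exact ⟨T, rfl⟩
  have hne : {r : ℝ | ∃ T : Finset L, I.Covers T σ.toFinset ∧ r = I.setCost T}.Nonempty :=
    ⟨_, ALG σ, h1.2 σ, rfl⟩
  obtain ⟨T, hT, hr⟩ := hne.csInf_mem hfin
  have h3 : I.optCost σ.toFinset = I.setCost T := hr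
  rw [h3]
  exact h2 σ T hT
end
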